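/- arXiv:1608.01390 — 5 statements merged into one kernel-verified Lean document; each statement's English description precedes it below -/
import Mathlib

section
/- Let K be an imaginary quadratic field, let p be a prime, let a ≥ 1, and let L ⊆ K be a rank-1 K-lattice of conductor p^a. Among the p + 1 rank-1 K-lattices L′ with L ⊆ L′ and L′/L of order p, exactly one has conductor p^{a−1}, none has conductor p^a, and exactly p have conductor p^{a+1}. -/
noncomputable section

variable (K : Type) [Field K] [NumberField K]

/-- The underlying set of the order `ℤ + m·O_K` of conductor `m` in `K`. -/
def orderSet (m : ℕ) : Set K :=
  {x : K | ∃ (a : ℤ) (y : NumberField.RingOfIntegers K),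
    x = (a : K) + (m : K) * algebraMap (NumberField.RingOfIntegers K) K y}

/-- `L` is a rank-1 `K`-lattice: a finitely generated `ℤ`-submodule of `K`
spanning `K` over `ℚ`. -/
def IsLat (L : Submodule ℤ K) : Prop :=
  L.FG ∧ Submodule.span ℚ (L : Set K) = ⊤

/-- The multiplier ring `R(L) = {α ∈ K : α·L ⊆ L}` of a lattice, as a `ℤ`-submodule. -/
def multLat (L : Submodule ℤ K) : Submodule ℤ K where
  carrier := {α : K | ∀ x ∈ L, α * x ∈ L}
  add_mem' := by
    intro a b ha hb x hx
    rw [add_mul]; exact L.add_mem (ha x hx) (hb x hx)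
  zero_mem' := by intro x hx; rw [zero_mul]; exact L.zero_mem
  smul_mem' := by
    intro n a ha x hx
    rw [smul_mul_assoc]; exact L.smul_mem n (ha x hx)

/-- `L` has conductor `c`, i.e. the multiplier ring of `L` is the order `ℤ + c·O_K`. -/
def HasCond (L : Submodule ℤ K) (c : ℕ) : Prop :=
  0 < c ∧ (multLat K L : Set K) = orderSet K c

/-- The quotient group `L'/L`. -/
def quotLat (L L' : Submodule ℤ K) : Type :=
  L' ⧸ (L.comap L'.subtype)

instance (L L' : Submodule ℤ K) : AddCommGroup (quotLat K L L') :=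
  inferInstanceAs (AddCommGroup (L' ⧸ (L.comap L'.subtype)))

/-- The number of rank-1 `K`-lattices `L' ⊇ L` with `L'/L` of order `N` and `L'` of
conductor `b`. -/
def cntOrd (L : Submodule ℤ K) (b N : ℕ) : ℕ :=
  Nat.card {L' : Submodule ℤ K //
    L ≤ L' ∧ IsLat K L' ∧ Nat.card (quotLat K L L') = N ∧ HasCond K L' b}

set_option linter.unusedSectionVars false

theorem card_addSubgroup_of_zmod_module {V : Type*} [AddCommGroup V] (p : ℕ) [hp : Fact p.Prime]
    [Module (ZMod p) V] (hcard : Nat.card V = p ^ 2) :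
    Nat.card {W : AddSubgroup V // Nat.card W = p} = p + 1 := by
  have hinj := Nat.pow_right_injective hp.out.two_le
  have : Finite V := Nat.finite_of_card_ne_zero (by rw [hcard]; exact pow_ne_zero _ hp.out.ne_zero)
  have hcd (W : Submodule (ZMod p) V) : Nat.card W = p ^ Module.finrank (ZMod p) W := by
    rw [Module.natCard_eq_pow_finrank (K := ZMod p) (V := W), Nat.card_zmod]
  have hfr : Module.finrank (ZMod p) V = 2 := by
    have := Module.natCard_eq_pow_finrank (K := ZMod p) (V := V)
    rw [hcard, Nat.card_zmod] at this
    exact (hinj this).symm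
  have e : {W : AddSubgroup V // Nat.card W = p} ≃
      {W : Submodule (ZMod p) V // Module.finrank (ZMod p) W = 1} :=
    (AddSubgroup.toZModSubmodule p).toEquiv.subtypeEquiv fun W => by
      have h1 : Nat.card W = p ^ Module.finrank (ZMod p) (AddSubgroup.toZModSubmodule p W) :=
        hcd (AddSubgroup.toZModSubmodule p W)
      rw [h1]
      exact ⟨fun h => hinj (h.trans (pow_one p).symm),
        fun h => (congrArg (p ^ ·) h).trans (pow_one p)⟩
  rw [Nat.card_congr (e.trans (Projectivization.equivSubmodule (ZMod p) V).symm),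
    Projectivization.card_of_finrank_two _ _ hfr, Nat.card_zmod]

theorem card_addSubgroup_of_card_sq {V : Type*} [AddCommGroup V] {p : ℕ} (hp : p.Prime)
    (hV : ∀ x : V, p • x = 0) (hcard : Nat.card V = p ^ 2) :
    Nat.card {W : AddSubgroup V // Nat.card W = p} = p + 1 := by
  have := Fact.mk hp
  let := AddCommGroup.zmodModule hV
  exact card_addSubgroup_of_zmod_module p hcard

theorem card_addSubgroup_between {G : Type*} [AddCommGroup G] {p : ℕ} (hp : p.Prime)
    {H P : AddSubgroup G} (hHP : H ≤ P) (hP : ∀ x ∈ P, p • x ∈ H) (hidx : H.relIndex P = p ^ 2) :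
    Nat.card {X : AddSubgroup G // H ≤ X ∧ X ≤ P ∧ H.relIndex X = p} = p + 1 := by
  let π := QuotientAddGroup.mk' (H.addSubgroupOf P)
  have hπ : ∀ x, π x = 0 ↔ (x : G) ∈ H := fun x => by
    simp [π, AddSubgroup.mem_addSubgroupOf]
  have hsurj : Function.Surjective π := QuotientAddGroup.mk'_surjective _
  have hker : π.ker = H.addSubgroupOf P := QuotientAddGroup.ker_mk' _
  rw [← card_addSubgroup_of_card_sq hp (V := P ⧸ H.addSubgroupOf P) ?_ hidx]
  · refine Nat.card_congr (Equiv.ofBijective (fun X => ⟨(X.1.addSubgroupOf P).map π, ?_⟩) ⟨?_, ?_⟩)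
    · rw [← AddSubgroup.relIndex_ker, hker, AddSubgroup.relIndex_addSubgroupOf X.2.2.1]
      exact X.2.2.2
    · rintro ⟨X, hX⟩ ⟨Y, hY⟩ h
      have h' : (X.addSubgroupOf P).map π = (Y.addSubgroupOf P).map π := congrArg Subtype.val h
      have h2 := congrArg (AddSubgroup.comap π) h'
      rw [AddSubgroup.comap_map_eq_self, AddSubgroup.comap_map_eq_self] at h2
      · exact Subtype.ext ((AddSubgroup.addSubgroupOf_inj.1 h2 |> fun h3 => by
          rwa [inf_eq_left.2 hX.2.1, inf_eq_left.2 hY.2.1] at h3))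
      · rw [hker]; exact fun x hx => hY.1 hx
      · rw [hker]; exact fun x hx => hX.1 hx
    · rintro ⟨W, hW⟩
      have hle : (W.comap π).map P.subtype ≤ P := AddSubgroup.map_subtype_le _
      have key : ((((W.comap π).map P.subtype).addSubgroupOf P)).map π = W := by
        change (((W.comap π).map P.subtype).comap P.subtype).map π = W
        rw [AddSubgroup.comap_map_eq_self_of_injective P.subtype_injective, AddSubgroup.map_comap_eq_self_of_surjective hsurj]
      refine ⟨⟨(W.comap π).map P.subtype, ?_, hle, ?_⟩, Subtype.ext key⟩
      · intro x hx
        exact ⟨⟨x, hHP hx⟩, show π _ ∈ W by rw [(hπ _).2 hx]; exact W.zero_mem, rfl⟩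
      · have hk := AddSubgroup.relIndex_ker (((W.comap π).map P.subtype).addSubgroupOf P) π
        rwa [hker, key, hW, AddSubgroup.relIndex_addSubgroupOf hle] at hk
  · intro x
    obtain ⟨y, rfl⟩ := hsurj x
    rw [← map_nsmul, hπ]
    exact hP _ y.2

theorem relIndex_sq_of_isLattice {K : Type} [Field K] [NumberField K]
    (hdeg : Module.finrank ℚ K = 2) {p : ℕ} (hp : p.Prime) {L P : Submodule ℤ K}
    (hL : L.FG) (hL' : Submodule.span ℚ (L : Set K) = ⊤)
    (hP : ∀ x, x ∈ P ↔ (p : K) * x ∈ L) :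
    L.toAddSubgroup.relIndex P.toAddSubgroup = p ^ 2 := by
  have : L.IsLattice ℚ := ⟨hL, hL'⟩
  have hp0 : (p : K) ≠ 0 := Nat.cast_ne_zero.2 hp.ne_zero
  have hmap : P.toAddSubgroup.map (nsmulAddMonoidHom (α := K) p) = L.toAddSubgroup := by
    ext x
    simp only [AddSubgroup.mem_map, Submodule.mem_toAddSubgroup, nsmulAddMonoidHom_apply,
      nsmul_eq_mul, hP]
    refine ⟨fun ⟨y, hy, h⟩ => h ▸ hy, fun h => ⟨x / p, ?_, ?_⟩⟩ <;> field_simp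
    exact h
  have hr : Module.finrank ℤ L = 2 := by
    rw [← hdeg]
    exact congrArg Cardinal.toNat (Submodule.IsLattice.rank' ℚ L)
  have h1 : Module.Free ℤ L := inferInstance
  have h2 : Module.Finite ℤ L := inferInstance
  have hinj : Function.Injective (nsmulAddMonoidHom (α := K) p) := fun x y h => by
    simpa [hp0, hp.ne_zero] using h
  rw [← AddSubgroup.relIndex_map_map_of_injective _ _ hinj, hmap, ← hr]
  have : Module.Free ℤ L.toAddSubgroup.toIntSubmodule := h1
  have : Module.Finite ℤ L.toAddSubgroup.toIntSubmodule := h2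
  exact AddSubgroup.relIndex_map_nsmul p L.toAddSubgroup

theorem exists_integral_generator {K : Type} [Field K] [NumberField K]
    (hdeg : Module.finrank ℚ K = 2) :
    ∃ w : K, IsIntegral ℤ w ∧ (∀ x : K, IsIntegral ℤ x → ∃ i j : ℤ, x = i + j * w) ∧
      ∀ i j : ℤ, (i : K) + j * w = 0 → i = 0 ∧ j = 0 := by
  have hr : Module.finrank ℤ (NumberField.RingOfIntegers K) = 2 := by
    rw [NumberField.RingOfIntegers.rank, hdeg]
  let b := Module.finBasisOfFinrankEq ℤ (NumberField.RingOfIntegers K) hr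
  have hrep : ∀ x : NumberField.RingOfIntegers K, x = b.repr x 0 • b 0 + b.repr x 1 • b 1 :=
    fun x => by
      conv_lhs => rw [← b.sum_repr x, Fin.sum_univ_two]
  have hli : ∀ i j : ℤ, i • b 0 + j • b 1 = 0 → i = 0 ∧ j = 0 := fun i j h =>
    LinearIndependent.pair_iff.1 (by
      have := b.linearIndependent
      rw [show (b : Fin 2 → _) = ![b 0, b 1] by ext i; fin_cases i <;> rfl] at this
      exact this) i j h
  obtain ⟨m, n, hmn⟩ : ∃ m n : ℤ, (1 : NumberField.RingOfIntegers K) = m • b 0 + n • b 1 :=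
    ⟨_, _, hrep 1⟩
  have hco : IsCoprime m n := by
    have hu : ∀ d : ℤ, d ∣ m → d ∣ n → IsUnit d := by
      rintro d ⟨m', rfl⟩ ⟨n', rfl⟩
      refine (isUnit_map_iff (algebraMap ℤ (NumberField.RingOfIntegers K)) _).1
        (IsUnit.of_mul_eq_one (m' • b 0 + n' • b 1) ?_)
      rw [hmn]
      simp only [zsmul_eq_mul, eq_intCast]
      push_cast
      ring
    rw [Int.isCoprime_iff_gcd_eq_one]
    simpa [Int.isUnit_iff] using hu _ (Int.gcd_dvd_left m n) (Int.gcd_dvd_right m n)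
  obtain ⟨u, v, huv⟩ := hco
  have huvK : ((u * m + v * n : ℤ) : NumberField.RingOfIntegers K) = 1 := by rw [huv]; simp
  simp only [zsmul_eq_mul] at hmn hli hrep
  push_cast at huvK
  refine ⟨((-v * b 0 + u * b 1 : NumberField.RingOfIntegers K) : K),
    NumberField.RingOfIntegers.isIntegral_coe _, fun x hx => ?_, fun i j h => ?_⟩
  · obtain ⟨y, rfl⟩ : ∃ y : NumberField.RingOfIntegers K, (y : K) = x := ⟨⟨x, hx⟩, rfl⟩
    obtain ⟨s, t, hst⟩ : ∃ s t : ℤ, y = s * b 0 + t * b 1 := ⟨_, _, hrep y⟩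
    refine ⟨s * u + t * v, t * m - s * n, ?_⟩
    have : y = ((s * u + t * v : ℤ) : NumberField.RingOfIntegers K) +
        ((t * m - s * n : ℤ) : NumberField.RingOfIntegers K) * (-v * b 0 + u * b 1) := by
      push_cast
      linear_combination hst - (s * b 0 + t * b 1) * huvK - (s * u + t * v) * hmn
    simpa using! congrArg (algebraMap (NumberField.RingOfIntegers K) K) this
  · have h' : (i : NumberField.RingOfIntegers K) + j * (-v * b 0 + u * b 1) = 0 := by
      apply NumberField.RingOfIntegers.coe_injective
      simpa using h
    obtain ⟨h1, h2⟩ := hli (i * m - j * v) (i * n + j * u) (by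
      push_cast
      linear_combination h' - i * hmn)
    constructor
    · linear_combination (-i) * huv + u * h1 + v * h2
    · linear_combination (-j) * huv - n * h1 + m * h2

theorem natCard_quotLat (L L' : Submodule ℤ K) :
    Nat.card (quotLat K L L') = L.toAddSubgroup.relIndex L'.toAddSubgroup := rfl

variable {K}

/-- The lattice `m⁻¹ L`. -/
def divLat (m : ℕ) (L : Submodule ℤ K) : Submodule ℤ K :=
  L.comap (LinearMap.mulLeft ℤ (m : K))

theorem mem_divLat {m : ℕ} {L : Submodule ℤ K} {x : K} : x ∈ divLat m L ↔ (m : K) * x ∈ L :=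
  Iff.rfl

theorem intCast_mul_mem {L : Submodule ℤ K} (n : ℤ) {x : K} (hx : x ∈ L) : (n : K) * x ∈ L := by
  simpa using L.smul_mem n hx

theorem natCast_mul_mem {L : Submodule ℤ K} (n : ℕ) {x : K} (hx : x ∈ L) : (n : K) * x ∈ L := by
  simpa using intCast_mul_mem n hx

theorem le_divLat (m : ℕ) (L : Submodule ℤ K) : L ≤ divLat m L := fun _ hx => natCast_mul_mem m hx

theorem le_divLat_of_relIndex {L L' : Submodule ℤ K} {m : ℕ}
    (h : L.toAddSubgroup.relIndex L'.toAddSubgroup = m) : L' ≤ divLat m L := by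
  intro y hy
  have := (L.toAddSubgroup.addSubgroupOf L'.toAddSubgroup).nsmul_index_mem ⟨y, hy⟩
  rw [show (L.toAddSubgroup.addSubgroupOf L'.toAddSubgroup).index = m from h,
    AddSubgroup.mem_addSubgroupOf] at this
  simpa [mem_divLat] using! this

theorem IsLat.of_le_of_le_divLat {L L' : Submodule ℤ K} {m : ℕ} (hm : m ≠ 0) (hL : IsLat K L)
    (h : L ≤ L') (h' : L' ≤ divLat m L) : IsLat K L' := by
  refine ⟨?_, top_le_iff.1 (hL.2 ▸ Submodule.span_mono h)⟩
  have := isNoetherian_of_fg_of_noetherian L hL.1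
  refine Submodule.fg_of_fg_map_injective (LinearMap.mulLeft ℤ (m : K))
    (fun x y hxy => by simpa [hm] using hxy) ?_
  exact Submodule.FG.of_le_of_isNoetherian (Submodule.map_le_iff_le_comap.2 h')

theorem isLat_of_relIndex {L L' : Submodule ℤ K} {p : ℕ} (hp : p.Prime) (hL : IsLat K L)
    (h : L ≤ L') (hidx : L.toAddSubgroup.relIndex L'.toAddSubgroup = p) : IsLat K L' :=
  hL.of_le_of_le_divLat hp.ne_zero h (le_divLat_of_relIndex hidx)

theorem card_superlattices (hdeg : Module.finrank ℚ K = 2) {p : ℕ} (hp : p.Prime)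
    {L : Submodule ℤ K} (hL : IsLat K L) :
    Nat.card {L' : Submodule ℤ K //
      L ≤ L' ∧ IsLat K L' ∧ Nat.card (quotLat K L L') = p} = p + 1 := by
  rw [← card_addSubgroup_between hp (H := L.toAddSubgroup) (P := (divLat p L).toAddSubgroup)
    (le_divLat p L) (fun x hx => by simpa using! (mem_divLat.1 hx))
    (relIndex_sq_of_isLattice hdeg hp hL.1 hL.2 fun _ => mem_divLat)]
  refine Nat.card_congr (AddSubgroup.toIntSubmodule.symm.toEquiv.subtypeEquiv fun L' => ?_)
  rw [natCard_quotLat]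
  exact ⟨fun h => ⟨h.1, le_divLat_of_relIndex h.2.2, h.2.2⟩,
    fun h => ⟨h.1, isLat_of_relIndex hp hL h.1 h.2.2, h.2.2⟩⟩

/-- `w` generates the ring of integers of `K` over `ℤ`, with `1, w` independent. -/
structure IsGen (w : K) : Prop where
  isIntegral : IsIntegral ℤ w
  exists_eq : ∀ x : K, IsIntegral ℤ x → ∃ i j : ℤ, x = i + j * w
  indep : ∀ i j : ℤ, (i : K) + j * w = 0 → i = 0 ∧ j = 0

theorem IsGen.eq_of_eq {w : K} (hw : IsGen w) {i j k l : ℤ}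
    (h : (i : K) + j * w = k + l * w) : j = l := by
  have := hw.indep (i - k) (j - l) (by push_cast; linear_combination h)
  linarith [this.2]

theorem IsGen.mem_orderSet {w : K} (hw : IsGen w) {m : ℕ} {x : K} :
    x ∈ orderSet K m ↔ ∃ i j : ℤ, x = i + (m * j : ℤ) * w := by
  constructor
  · rintro ⟨a, y, rfl⟩
    obtain ⟨i, j, h⟩ := hw.exists_eq _ (NumberField.RingOfIntegers.isIntegral_coe y)
    refine ⟨a + m * i, j, ?_⟩
    rw [h]
    push_cast
    ring
  · rintro ⟨i, j, rfl⟩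
    refine ⟨i, ⟨j * w, (isIntegral_algebraMap (x := j)).mul hw.isIntegral⟩, ?_⟩
    change _ = (i : K) + m * (j * w)
    push_cast
    ring

theorem IsGen.orderSet_pow_injective {w : K} (hw : IsGen w) {p : ℕ} (hp : p.Prime) :
    Function.Injective fun k => orderSet K (p ^ k) := by
  have key : ∀ j k, orderSet K (p ^ j) = orderSet K (p ^ k) → k ≤ j := by
    intro j k h
    have h1 : ((p ^ j : ℕ) : K) * w ∈ orderSet K (p ^ j) :=
      hw.mem_orderSet.2 ⟨0, 1, by push_cast; ring⟩
    rw [h] at h1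
    obtain ⟨i, l, h2⟩ := hw.mem_orderSet.1 h1
    have h3 : ((p ^ j : ℕ) : ℤ) = (p ^ k : ℕ) * l :=
      hw.eq_of_eq (i := 0) (k := i) (by push_cast at h2 ⊢; rw [zero_add, h2])
    exact (Nat.pow_dvd_pow_iff_le_right hp.one_lt).1 (Int.natCast_dvd_natCast.1 ⟨l, h3⟩)
  exact fun j k h => le_antisymm (key k j h.symm) (key j k h)

theorem IsGen.mul_mem_of_multLat_eq {w : K} (hw : IsGen w) {M : Submodule ℤ K} {m : ℕ}
    (h : (multLat K M : Set K) = orderSet K m) {c : ℤ} (hc : (m : ℤ) ∣ c) {x : K} (hx : x ∈ M) :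
    (c : K) * w * x ∈ M := by
  obtain ⟨l, rfl⟩ := hc
  have : ((m * l : ℤ) : K) * w ∈ orderSet K m :=
    hw.mem_orderSet.2 ⟨0, l, by simp⟩
  rw [← h] at this
  exact this x hx

theorem isIntegral_of_mem_multLat {L : Submodule ℤ K} (hL : IsLat K L) {β : K}
    (hβ : β ∈ multLat K L) : IsIntegral ℤ β := by
  refine isIntegral_of_smul_mem_submodule L ?_ hL.1 β hβ
  rintro rfl
  have := hL.2
  simp at this

/-- The set of superlattices of `L` of index `p`. -/
def superLat (L : Submodule ℤ K) (p : ℕ) : Set (Submodule ℤ K) :=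
  {L' | L ≤ L' ∧ L.toAddSubgroup.relIndex L'.toAddSubgroup = p}

/-- The lattice of those `y ∈ p⁻¹ L` with `τ y ∈ L`. -/
def nilLat (p : ℕ) (τ : K) (L : Submodule ℤ K) : Submodule ℤ K :=
  divLat p L ⊓ L.comap (LinearMap.mulLeft ℤ τ)

theorem mem_nilLat {p : ℕ} {τ : K} {L : Submodule ℤ K} {y : K} :
    y ∈ nilLat p τ L ↔ (p : K) * y ∈ L ∧ τ * y ∈ L := Iff.rfl

section

variable {w : K} {p b : ℕ} {L L' : Submodule ℤ K}

theorem IsGen.generator_mul_mem (hw : IsGen w)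
    (hc : HasCond K L (p ^ (b + 1))) {x : K} (hx : x ∈ L) : (p : K) ^ (b + 1) * w * x ∈ L := by
  simpa using hw.mul_mem_of_multLat_eq hc.2 dvd_rfl hx

theorem IsGen.div_mul_mem_nilLat (hw : IsGen w) {y : K}
    (hy : y ∈ nilLat p ((p : K) ^ (b + 1) * w) L) :
    (p : K) ^ b * w * y ∈ nilLat p ((p : K) ^ (b + 1) * w) L := by
  obtain ⟨h1, h2⟩ := mem_nilLat.1 hy
  obtain ⟨m, n, hmn⟩ := hw.exists_eq _ (hw.isIntegral.mul hw.isIntegral)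
  refine mem_nilLat.2 ⟨by convert h2 using 1; ring, ?_⟩
  convert L.add_mem (intCast_mul_mem (p ^ (2 * b) * m) h1) (intCast_mul_mem (p ^ b * n) h2) using 1
  push_cast
  linear_combination (p : K) ^ (2 * b + 1) * y * hmn

theorem IsGen.generator_mul_mem_nilLat (hw : IsGen w)
    (hc : HasCond K L (p ^ (b + 1))) {y : K} (hy : (p : K) * y ∈ L) :
    (p : K) ^ (b + 1) * w * y ∈ nilLat p ((p : K) ^ (b + 1) * w) L := by
  obtain ⟨m, n, hmn⟩ := hw.exists_eq _ (hw.isIntegral.mul hw.isIntegral)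
  have h2 := hw.generator_mul_mem hc hy
  refine mem_nilLat.2 ⟨by convert h2 using 1; ring, ?_⟩
  convert L.add_mem (intCast_mul_mem (p ^ (2 * b + 1) * m) hy)
    (intCast_mul_mem (p ^ b * n) h2) using 1
  push_cast
  linear_combination (p : K) ^ (2 * b + 2) * y * hmn

theorem IsGen.exists_generator_mul_notMem (hw : IsGen w) (hp : p.Prime)
    (hc : HasCond K L (p ^ (b + 1))) :
    ∃ y, (p : K) * y ∈ L ∧ (p : K) ^ (b + 1) * w * y ∉ L := by
  by_contra! h
  have hp0 : (p : K) ≠ 0 := Nat.cast_ne_zero.2 hp.ne_zero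
  have h1 : (p : K) ^ b * w ∈ (multLat K L : Set K) := fun x hx => by
    convert h (x / p) (by field_simp; exact hx) using 1
    rw [pow_succ]
    field_simp
  rw [hc.2] at h1
  obtain ⟨i, l, h2⟩ := hw.mem_orderSet.1 h1
  have h3 : (p ^ b : ℤ) = (p ^ (b + 1) : ℕ) * l :=
    hw.eq_of_eq (i := 0) (k := i) (by push_cast at h2 ⊢; rw [zero_add, h2])
  have h4 : p ^ (b + 1) ∣ p ^ b := Int.natCast_dvd_natCast.1 ⟨l, by exact_mod_cast h3⟩
  have := (Nat.pow_dvd_pow_iff_le_right hp.one_lt).1 h4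
  omega

theorem le_nilLat (hw : IsGen w) (hc : HasCond K L (p ^ (b + 1))) :
    L ≤ nilLat p ((p : K) ^ (b + 1) * w) L := fun _ hx =>
  mem_nilLat.2 ⟨natCast_mul_mem p hx, hw.generator_mul_mem hc hx⟩

theorem IsGen.nilLat_mem_superLat (hw : IsGen w) (hdeg : Module.finrank ℚ K = 2) (hp : p.Prime)
    (hL : IsLat K L) (hc : HasCond K L (p ^ (b + 1))) :
    nilLat p ((p : K) ^ (b + 1) * w) L ∈ superLat L p := by
  set N := nilLat p ((p : K) ^ (b + 1) * w) L with hN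
  obtain ⟨y, hy, hy'⟩ := hw.exists_generator_mul_notMem hp hc
  have hLN : L.toAddSubgroup ≤ N.toAddSubgroup := le_nilLat hw hc
  have hNP : N.toAddSubgroup ≤ (divLat p L).toAddSubgroup := fun x hx => hx.1
  refine ⟨hLN, ?_⟩
  have hmul := AddSubgroup.relIndex_mul_relIndex _ _ _ hLN hNP
  rw [relIndex_sq_of_isLattice hdeg hp hL.1 hL.2 fun _ => mem_divLat] at hmul
  have h1 : L.toAddSubgroup.relIndex N.toAddSubgroup ≠ 1 := fun h =>
    hy' (AddSubgroup.relIndex_eq_one.1 h (hw.generator_mul_mem_nilLat hc hy))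
  have h2 : N.toAddSubgroup.relIndex (divLat p L).toAddSubgroup ≠ 1 := fun h =>
    hy' (AddSubgroup.relIndex_eq_one.1 h (show y ∈ _ from hy)).2
  exact ((hp.mul_eq_prime_sq_iff h1 h2).1 hmul).1

theorem IsGen.eq_nilLat_of_stable (hw : IsGen w) (hdeg : Module.finrank ℚ K = 2) (hp : p.Prime)
    (hL : IsLat K L) (hc : HasCond K L (p ^ (b + 1))) (hL' : L' ∈ superLat L p)
    (hs : ∀ y ∈ L', (p : K) ^ (b + 1) * w * y ∈ L') :
    L' = nilLat p ((p : K) ^ (b + 1) * w) L := by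
  set N := nilLat p ((p : K) ^ (b + 1) * w) L with hN
  have hNp := hw.nilLat_mem_superLat hdeg hp hL hc
  have hP := le_divLat_of_relIndex hL'.2
  have hi : L.toAddSubgroup ≤ L'.toAddSubgroup ⊓ N.toAddSubgroup := le_inf hL'.1 hNp.1
  have hmul := AddSubgroup.relIndex_mul_relIndex _ _ _ hi
    (inf_le_left : L'.toAddSubgroup ⊓ N.toAddSubgroup ≤ L'.toAddSubgroup)
  rw [hL'.2] at hmul
  have hle : L'.toAddSubgroup ≤ N.toAddSubgroup := by
    rcases (Nat.dvd_prime hp).1 ⟨_, hmul.symm⟩ with h | h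
    · have h0 := AddSubgroup.relIndex_eq_one.1 h
      have h1 : L'.toAddSubgroup ≤ L.toAddSubgroup := fun y hy => by
        refine h0 ⟨hy, mem_nilLat.2 ⟨hP hy, ?_⟩⟩
        exact h0 ⟨hs y hy, hw.generator_mul_mem_nilLat hc (hP hy)⟩
      have := hL'.2
      rw [AddSubgroup.relIndex_eq_one.2 h1] at this
      exact absurd this.symm hp.one_lt.ne'
    · rw [h] at hmul
      exact (le_inf_iff.1 (AddSubgroup.relIndex_eq_one.1
        (Nat.eq_of_mul_eq_mul_left hp.pos (hmul.trans (mul_one p).symm)))).2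
  have hmul' := AddSubgroup.relIndex_mul_relIndex L.toAddSubgroup _ _ hL'.1 hle
  rw [hL'.2, hNp.2] at hmul'
  have hge : N ≤ L' := AddSubgroup.relIndex_eq_one.1
    (Nat.eq_of_mul_eq_mul_left hp.pos (hmul'.trans (mul_one p).symm))
  exact le_antisymm hle hge

theorem IsGen.exists_eq_of_mem_multLat (hw : IsGen w) (hp : p.Prime)
    (hL : IsLat K L) (hc : HasCond K L (p ^ (b + 1))) (hL' : L' ∈ superLat L p) {β : K}
    (hβ : β ∈ multLat K L') : ∃ i j : ℤ, β = i + (p ^ b * j : ℤ) * w := by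
  obtain ⟨i, j, rfl⟩ := hw.exists_eq β
    (isIntegral_of_mem_multLat (isLat_of_relIndex hp hL hL'.1 hL'.2) hβ)
  have h1 : (p : K) * (i + j * w) ∈ (multLat K L : Set K) := fun x hx => by
    rw [mul_assoc]
    exact le_divLat_of_relIndex hL'.2 (hβ x (hL'.1 hx))
  rw [hc.2] at h1
  obtain ⟨k, l, h2⟩ := hw.mem_orderSet.1 h1
  have h3 : (p * j : ℤ) = (p ^ (b + 1) : ℕ) * l :=
    hw.eq_of_eq (i := p * i) (k := k) (by push_cast at h2 ⊢; linear_combination h2)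
  refine ⟨i, l, ?_⟩
  have hp0 : (p : ℤ) ≠ 0 := Nat.cast_ne_zero.2 hp.ne_zero
  rw [mul_left_cancel₀ hp0 (b := j) (c := p ^ b * l) (by rw [h3]; push_cast; ring)]

theorem intCast_mem_multLat (M : Submodule ℤ K) (i : ℤ) : (i : K) ∈ multLat K M :=
  fun _ hx => intCast_mul_mem i hx

theorem IsGen.hasCond_nilLat (hw : IsGen w) (hdeg : Module.finrank ℚ K = 2) (hp : p.Prime)
    (hL : IsLat K L) (hc : HasCond K L (p ^ (b + 1))) :
    HasCond K (nilLat p ((p : K) ^ (b + 1) * w) L) (p ^ b) := by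
  refine ⟨pow_pos hp.pos b, Set.ext fun β => ⟨fun hβ => ?_, fun hβ => ?_⟩⟩
  · obtain ⟨i, j, rfl⟩ := hw.exists_eq_of_mem_multLat hp hL hc
      (hw.nilLat_mem_superLat hdeg hp hL hc) hβ
    exact hw.mem_orderSet.2 ⟨i, j, by push_cast; rfl⟩
  · obtain ⟨i, j, rfl⟩ := hw.mem_orderSet.1 hβ
    refine add_mem (intCast_mem_multLat _ i) fun y hy => ?_
    convert intCast_mul_mem j (hw.div_mul_mem_nilLat hy) using 1
    push_cast
    ring

theorem IsGen.hasCond_of_not_stable (hw : IsGen w) (hp : p.Prime)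
    (hL : IsLat K L) (hc : HasCond K L (p ^ (b + 1))) (hL' : L' ∈ superLat L p)
    (hs : ¬ ∀ y ∈ L', (p : K) ^ (b + 1) * w * y ∈ L') :
    HasCond K L' (p ^ (b + 2)) := by
  have htop : (p : K) ^ (b + 2) * w ∈ multLat K L' := fun y hy => hL'.1 <| by
    convert hw.generator_mul_mem hc (mem_divLat.1 (le_divLat_of_relIndex hL'.2 hy)) using 1
    ring
  refine ⟨pow_pos hp.pos _, Set.ext fun β => ⟨fun hβ => ?_, fun hβ => ?_⟩⟩
  · obtain ⟨i, j, rfl⟩ := hw.exists_eq_of_mem_multLat hp hL hc hL' hβ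
    have hj : ((p ^ b * j : ℤ) : K) * w ∈ multLat K L' := by
      simpa using sub_mem hβ (intCast_mem_multLat L' i)
    obtain ⟨l, rfl⟩ : (p ^ 2 : ℤ) ∣ j := by
      by_contra hnd
      refine hs ?_
      obtain ⟨k, hk, hgcd⟩ := (Nat.dvd_prime_pow hp).1
        (Int.natCast_dvd_natCast.1 (by simpa using Int.gcd_dvd_right j (p ^ 2 : ℤ)) :
          Int.gcd j (p ^ 2 : ℤ) ∣ p ^ 2)
      have hk1 : k ≤ 1 := by
        by_contra hk1
        obtain rfl : k = 2 := by omega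
        refine hnd ?_
        have := Int.gcd_dvd_left j (p ^ 2 : ℤ)
        rw [hgcd] at this
        exact_mod_cast this
      have hbez := Int.gcd_eq_gcd_ab j (p ^ 2 : ℤ)
      rw [hgcd] at hbez
      have hpk : ((p : K) ^ k) * p ^ (1 - k) = p := by
        rw [← pow_add, Nat.add_sub_cancel' hk1, pow_one]
      have hbezK := congrArg (Int.cast : ℤ → K) hbez
      push_cast at hbezK
      intro y hy
      convert intCast_mul_mem (p ^ (1 - k)) (L'.add_mem
        (intCast_mul_mem (Int.gcdA j (p ^ 2)) (hj y hy))
        (intCast_mul_mem (Int.gcdB j (p ^ 2)) (htop y hy))) using 1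
      push_cast
      linear_combination (p : K) ^ b * w * y * (p ^ (1 - k) * hbezK - hpk)
    exact hw.mem_orderSet.2 ⟨i, l, by push_cast; ring⟩
  · obtain ⟨i, j, rfl⟩ := hw.mem_orderSet.1 hβ
    refine add_mem (intCast_mem_multLat _ i) fun y hy => ?_
    convert intCast_mul_mem j (htop y hy) using 1
    push_cast
    ring

theorem IsGen.hasCond_iff (hw : IsGen w) (hdeg : Module.finrank ℚ K = 2) (hp : p.Prime)
    (hL : IsLat K L) (hc : HasCond K L (p ^ (b + 1))) (hL' : L' ∈ superLat L p) (k : ℕ) :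
    HasCond K L' (p ^ k) ↔
      if L' = nilLat p ((p : K) ^ (b + 1) * w) L then k = b else k = b + 2 := by
  have hiff : ∀ {l}, HasCond K L' (p ^ l) → (HasCond K L' (p ^ k) ↔ k = l) := fun {l} hl =>
    ⟨fun hk => hw.orderSet_pow_injective hp (hk.2.symm.trans hl.2), fun h => h ▸ hl⟩
  split_ifs with h
  · exact hiff (h ▸ hw.hasCond_nilLat hdeg hp hL hc)
  · exact hiff (hw.hasCond_of_not_stable hp hL hc hL'
      fun hs => h (hw.eq_nilLat_of_stable hdeg hp hL hc hL' hs))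

end

theorem cntOrd_eq_ncard {p : ℕ} (hp : p.Prime) {L : Submodule ℤ K} (hL : IsLat K L) (c : ℕ) :
    cntOrd K L c p = {L' ∈ superLat L p | HasCond K L' c}.ncard := by
  refine Nat.card_congr (Equiv.subtypeEquivRight fun L' => ?_)
  rw [natCard_quotLat]
  exact ⟨fun h => ⟨⟨h.1, h.2.2.1⟩, h.2.2.2⟩,
    fun h => ⟨h.1.1, isLat_of_relIndex hp hL h.1.1 h.1.2, h.1.2, h.2⟩⟩

variable (K)

/-- For a lattice `L` of conductor `p^a` (`a ≥ 1`): among the `p + 1` superlattices of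
index `p`, exactly one has conductor `p^{a−1}`, none has conductor `p^a`, and exactly
`p` have conductor `p^{a+1}`. -/
theorem index_p_superlattices_of_nonmaximal
    (hdeg : Module.finrank ℚ K = 2)
    (himag : IsEmpty (K →+* ℝ))
    (p : ℕ) (hp : p.Prime) (a : ℕ) (ha : 1 ≤ a)
    (L : Submodule ℤ K) (hL : IsLat K L) (hc : HasCond K L (p ^ a)) :
    Nat.card {L' : Submodule ℤ K //
        L ≤ L' ∧ IsLat K L' ∧ Nat.card (quotLat K L L') = p} = p + 1 ∧
    cntOrd K L (p ^ (a - 1)) p = 1 ∧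
    cntOrd K L (p ^ a) p = 0 ∧
    cntOrd K L (p ^ (a + 1)) p = p := by
  obtain ⟨b, rfl⟩ : ∃ b, a = b + 1 := ⟨a - 1, by omega⟩
  obtain ⟨w, h1, h2, h3⟩ := exists_integral_generator hdeg
  have hw : IsGen w := ⟨h1, h2, h3⟩
  have hcard := card_superlattices hdeg hp hL
  have hN := hw.nilLat_mem_superLat hdeg hp hL hc
  have hiff := fun {L'} hL' => hw.hasCond_iff (L' := L') hdeg hp hL hc hL'
  set N := nilLat p ((p : K) ^ (b + 1) * w) L
  have hS : (superLat L p).ncard = p + 1 := by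
    rw [← hcard]
    refine Nat.card_congr (Equiv.subtypeEquivRight fun L' => ?_)
    rw [natCard_quotLat]
    exact ⟨fun h => ⟨h.1, isLat_of_relIndex hp hL h.1 h.2, h.2⟩, fun h => ⟨h.1, h.2.2⟩⟩
  refine ⟨hcard, ?_, ?_, ?_⟩ <;> rw [cntOrd_eq_ncard hp hL]
  · rw [Set.ncard_eq_one]
    refine ⟨N, Set.ext fun L' => ⟨fun h => ?_, ?_⟩⟩
    · have := (hiff h.1 _).1 h.2
      split_ifs at this with h'
      · exact h'
      · omega
    · rintro rfl
      exact ⟨hN, (hiff hN _).2 (by simp)⟩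
  · rw [show {L' ∈ superLat L p | HasCond K L' (p ^ (b + 1))} = ∅ from
      Set.eq_empty_of_forall_notMem fun L' h => ?_, Set.ncard_empty]
    have := (hiff h.1 _).1 h.2
    split_ifs at this <;> omega
  · rw [show {L' ∈ superLat L p | HasCond K L' (p ^ (b + 1 + 1))} = superLat L p \ {N} from
      Set.ext fun L' => ⟨fun h => ⟨h.1, fun h' => ?_⟩, fun h => ⟨h.1, ?_⟩⟩,
      Set.ncard_sdiff_singleton_of_mem hN, hS, Nat.add_sub_cancel]
    · have := (hiff h.1 _).1 h.2
      rw [if_pos (Set.mem_singleton_iff.1 h')] at this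
      omega
    · exact (hiff h.1 _).2 (by rw [if_neg (fun h' => h.2 (Set.mem_singleton_iff.2 h'))])

end
end

section
/- Let K be an imaginary quadratic field, let p be a prime, and let L ⊆ M be rank-1 K-lattices such that the index [M : L] is a power of p. Then for every prime ℓ ≠ p, the ℓ-adic valuations of the conductor of L and of the conductor of M are equal (i.e., the two conductors differ only by a power of p). -/
noncomputable section

variable (K : Type) [Field K] [NumberField K]

/-- If every element of `O_K` is congruent to an integer modulo `d`, with `K` quadratic,
then `d` is a unit. -/
theorem dvd_one_of_forall_eq_int_add_mul (hdeg : Module.finrank ℚ K = 2) (d : ℤ)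
    (h : ∀ y : NumberField.RingOfIntegers K,
      ∃ (a : ℤ) (z : NumberField.RingOfIntegers K), y = a + d * z) : d ∣ 1 := by
  have hrank : Module.finrank ℤ (NumberField.RingOfIntegers K) = 2 := by
    rw [NumberField.RingOfIntegers.rank, hdeg]
  let b := Module.finBasisOfFinrankEq ℤ (NumberField.RingOfIntegers K) hrank
  have key : ∀ i : Fin 2, ∃ (s : ℤ) (w : Fin 2 → ℤ),
      ∀ j, (if i = j then 1 else 0) = s * b.repr 1 j + d * w j := by
    intro i
    obtain ⟨s, z, hz⟩ := h (b i)
    refine ⟨s, fun j => b.repr z j, fun j => ?_⟩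
    have hz' : b i = s • 1 + d • z := by rw [hz]; simp
    have := congrArg (fun x => b.repr x j) hz'
    simpa only [map_add, map_smul, Finsupp.add_apply, Finsupp.smul_apply, smul_eq_mul,
      Module.Basis.repr_self, Finsupp.single_apply] using this
  obtain ⟨s, w, hs⟩ := key 0
  obtain ⟨t, x, ht⟩ := key 1
  have h00 := hs 0
  have h01 := hs 1
  have h10 := ht 0
  have h11 := ht 1
  simp only [↓reduceIte, zero_ne_one, one_ne_zero] at h00 h01 h10 h11
  set u := b.repr 1 0
  set v := b.repr 1 1
  refine ⟨w 0 + s * u * x 1 - s * v * x 0, ?_⟩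
  linear_combination h00 + s * u * h11 - s * v * h10

/-- If `m·O_K ⊆ ℤ + n·O_K` with `K` quadratic, then `n ∣ m`. -/
theorem dvd_of_forall_mul_mem_orderSet (hdeg : Module.finrank ℚ K = 2) (m n : ℕ) (hn : 0 < n)
    (h : ∀ y : NumberField.RingOfIntegers K,
      (m : K) * algebraMap (NumberField.RingOfIntegers K) K y ∈ orderSet K n) : n ∣ m := by
  have hg : 0 < m.gcd n := Nat.gcd_pos_of_pos_right m hn
  obtain ⟨d, hd⟩ := Nat.gcd_dvd_right m n
  have hbez := Nat.gcd_eq_gcd_ab m n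
  set g := m.gcd n with hg_def
  have hgK : (g : K) ≠ 0 := by exact_mod_cast hg.ne'
  have hdK : (n : K) = g * d := by exact_mod_cast congrArg (Nat.cast : ℕ → K) hd
  have hbezK : (g : K) = m * (m.gcdA n : ℤ) + n * (m.gcdB n : ℤ) := by
    exact_mod_cast congrArg (Int.cast : ℤ → K) hbez
  have hd1 : (d : ℤ) ∣ 1 := by
    refine dvd_one_of_forall_eq_int_add_mul K hdeg d fun y => ?_
    obtain ⟨a, z, haz⟩ := h y
    let z' : NumberField.RingOfIntegers K := (m.gcdA n) * z + (m.gcdB n) * y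
    have hgy : (g : K) * algebraMap _ K (y - d * z') = ((m.gcdA n * a : ℤ) : K) := by
      simp only [z', map_sub, map_mul, map_add, map_natCast, map_intCast]
      push_cast
      linear_combination (algebraMap _ K y) * hbezK + (m.gcdA n : K) * haz +
        ((m.gcdA n : K) * algebraMap _ K z + (m.gcdB n : K) * algebraMap _ K y) * hdK
    have hrat : algebraMap _ K (y - d * z') =
        algebraMap ℚ K (((m.gcdA n * a : ℤ) : ℚ) / g) := by
      rw [map_div₀, map_intCast, map_natCast, eq_div_iff hgK, mul_comm, hgy]
    have hint : IsIntegral ℤ (((m.gcdA n * a : ℤ) : ℚ) / g) := by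
      rw [← isIntegral_algebraMap_iff (algebraMap ℚ K).injective, ← hrat]
      exact NumberField.RingOfIntegers.isIntegral_coe _
    obtain ⟨r, hr⟩ := IsIntegrallyClosed.isIntegral_iff.mp hint
    refine ⟨r, z', ?_⟩
    apply NumberField.RingOfIntegers.coe_injective
    rw [← hr] at hrat
    simp only [map_sub, map_mul, map_natCast, eq_intCast, map_intCast] at hrat
    simp only [map_add, map_mul, map_intCast, Int.cast_natCast, map_natCast]
    linear_combination hrat
  have : d = 1 := Nat.dvd_one.mp (by exact_mod_cast hd1)
  rw [this, mul_one] at hd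
  rw [hd]
  exact Nat.gcd_dvd_left m n

/-- If multiplication by `q` carries `R(M)` into `R(L)`, then the conductor of `L` divides
`q` times the conductor of `M`. -/
theorem HasCond.dvd_mul_of_mul_mem_multLat (hdeg : Module.finrank ℚ K = 2)
    {L M : Submodule ℤ K} {c c' : ℕ} (hc : HasCond K L c) (hc' : HasCond K M c') (q : ℕ)
    (h : ∀ α ∈ multLat K M, (q : K) * α ∈ multLat K L) : c ∣ q * c' := by
  refine dvd_of_forall_mul_mem_orderSet K hdeg _ _ hc.1 fun y => ?_
  have hy : (c' : K) * algebraMap _ K y ∈ (multLat K M : Set K) := by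
    rw [hc'.2]
    exact ⟨0, y, by simp⟩
  rw [← hc.2]
  simpa [mul_assoc] using h _ hy

/-- The order of `M / L` carries `M` into `L`. -/
theorem card_quotLat_mul_mem {F : Type} [Field F] (L M : Submodule ℤ F) {x : F} (hx : x ∈ M) :
    (Nat.card (quotLat F L M) : F) * x ∈ L := by
  have h : Nat.card (quotLat F L M) •
      ((Submodule.Quotient.mk ⟨x, hx⟩ : M ⧸ L.comap M.subtype) : quotLat F L M) = 0 :=
    card_nsmul_eq_zero'
  have h2 : (Submodule.Quotient.mk (Nat.card (quotLat F L M) • ⟨x, hx⟩) :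
      M ⧸ L.comap M.subtype) = 0 := h
  rw [Submodule.Quotient.mk_eq_zero] at h2
  simpa using h2

/-- If `L ⊆ M` are rank-1 `K`-lattices with `[M : L]` a power of the prime `p`, then
the conductors of `L` and `M` have the same `ℓ`-adic valuation for every prime
`ℓ ≠ p`. -/
theorem conductor_valuation_eq_of_p_power_index
    (hdeg : Module.finrank ℚ K = 2)
    (himag : IsEmpty (K →+* ℝ))
    (p : ℕ) (hp : p.Prime)
    (L M : Submodule ℤ K) (hL : IsLat K L) (hM : IsLat K M) (hLM : L ≤ M)
    (hindex : ∃ k : ℕ, Nat.card (quotLat K L M) = p ^ k)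
    (c c' : ℕ) (hc : HasCond K L c) (hc' : HasCond K M c') :
    ∀ ℓ : ℕ, ℓ.Prime → ℓ ≠ p → c.factorization ℓ = c'.factorization ℓ := by
  obtain ⟨k, hk⟩ := hindex
  have hqM : ∀ x ∈ M, ((p ^ k : ℕ) : K) * x ∈ L := fun x hx =>
    hk ▸ card_quotLat_mul_mem L M hx
  have h1 : c ∣ p ^ k * c' := HasCond.dvd_mul_of_mul_mem_multLat K hdeg hc hc' _
    fun α hα x hx => by
      rw [mul_assoc]
      exact hqM _ (hα x (hLM hx))
  have h2 : c' ∣ p ^ k * c := HasCond.dvd_mul_of_mul_mem_multLat K hdeg hc' hc _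
    fun α hα x hx => by
      rw [mul_comm _ α, mul_assoc]
      exact hLM (hα _ (hqM x hx))
  have hle : ∀ ℓ : ℕ, ℓ ≠ p → ∀ a b : ℕ, 0 < b → a ∣ p ^ k * b →
      a.factorization ℓ ≤ b.factorization ℓ := by
    intro ℓ hne a b hb hab
    have hpk : p ^ k ≠ 0 := pow_ne_zero _ hp.ne_zero
    have ha : a ≠ 0 := ne_zero_of_dvd_ne_zero (mul_ne_zero hpk hb.ne') hab
    have := (Nat.factorization_le_iff_dvd ha (mul_ne_zero hpk hb.ne')).mpr hab ℓ
    rwa [Nat.factorization_mul hpk hb.ne', hp.factorization_pow, Finsupp.add_apply,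
      Finsupp.single_eq_of_ne hne, zero_add] at this
  intro ℓ _ hne
  exact le_antisymm (hle ℓ hne _ _ hc'.1 h1) (hle ℓ hne _ _ hc.1 h2)

end
end

section
/- Let K be an imaginary quadratic field. For any positive integers a, b, c and any rank-1 K-lattice L of conductor a, the number of rank-1 K-lattices L′ with L ⊆ L′ such that L′/L is cyclic of order c and L′ has conductor b equals ∏_p r_K(p^{v_p(a)}, p^{v_p(b)}, p^{v_p(c)}), the product over all primes p, where v_p denotes p-adic valuation and, for each prime p, r_K(p^x, p^y, p^z) is the number of rank-1 K-lattices M′ ⊇ M with M′/M cyclic of order p^z and M′ of conductor p^y, for any fixed rank-1 K-lattice M of conductor p^x (this count is independent of the choice of M). -/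
noncomputable section

variable (K : Type) [Field K] [NumberField K]

/-- The number of rank-1 `K`-lattices `L' ⊇ L` with `L'/L` cyclic of order `N` and `L'`
of conductor `b`; for `L` of conductor `a` this is the quantity `r_K(a, b, N)`. -/
def cnt (L : Submodule ℤ K) (b N : ℕ) : ℕ :=
  Nat.card {L' : Submodule ℤ K //
    L ≤ L' ∧ IsLat K L' ∧ IsAddCyclic (quotLat K L L') ∧
      Nat.card (quotLat K L L') = N ∧ HasCond K L' b}

/-- `L'` is generated over `L` by one element whose order modulo `L` is `c`. -/
def IsCycExt {V : Type*} [AddCommGroup V] (L L' : Submodule ℤ V) (c : ℕ) : Prop :=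
  ∃ x : V, L' = L ⊔ Submodule.span ℤ {x} ∧ ∀ n : ℤ, n • x ∈ L ↔ (c : ℤ) ∣ n

/-- The multiples of the endomorphism `T` that preserve `X` are exactly those by multiples
of `c`. -/
def HasIndex {V : Type*} [AddCommGroup V] (T : V →+ V) (X : Submodule ℤ V) (c : ℕ) : Prop :=
  ∀ n : ℤ, (∀ x ∈ X, n • T x ∈ X) ↔ (c : ℤ) ∣ n

section Extensions

variable {V : Type*} [AddCommGroup V]

theorem mem_sup_span_int {L : Submodule ℤ V} {x y : V} :
    y ∈ L ⊔ Submodule.span ℤ {x} ↔ ∃ m ∈ L, ∃ k : ℤ, m + k • x = y := by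
  simp only [Submodule.mem_sup, Submodule.mem_span_singleton]
  constructor
  · rintro ⟨m, hm, _, ⟨k, rfl⟩, h⟩
    exact ⟨m, hm, k, h⟩
  · rintro ⟨m, hm, k, h⟩
    exact ⟨m, hm, _, ⟨k, rfl⟩, h⟩

theorem self_mem_sup_span {L : Submodule ℤ V} {x : V} : x ∈ L ⊔ Submodule.span ℤ {x} :=
  (le_sup_right : _ ≤ L ⊔ _) (Submodule.mem_span_singleton_self x)

theorem exists_bezout {s t : ℕ} (h : s.Coprime t) : ∃ u v : ℤ, u * s + v * t = 1 :=
  (Nat.isCoprime_iff_coprime.2 h)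

theorem mem_of_coprime_smul_mem {L : Submodule ℤ V} {s t : ℕ} (h : s.Coprime t) {x : V}
    (hs : (s : ℤ) • x ∈ L) (ht : (t : ℤ) • x ∈ L) : x ∈ L := by
  obtain ⟨u, v, huv⟩ := exists_bezout h
  have : x = u • ((s : ℤ) • x) + v • ((t : ℤ) • x) := by
    rw [smul_smul, smul_smul, ← add_smul, huv, one_smul]
  rw [this]
  exact L.add_mem (L.smul_mem _ hs) (L.smul_mem _ ht)

/-- The submodule of all `x` with `c • x ∈ L`. -/
def divBy (L : Submodule ℤ V) (c : ℕ) : Submodule ℤ V :=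
  L.comap (LinearMap.lsmul ℤ V (c : ℤ))

theorem mem_divBy {L : Submodule ℤ V} {c : ℕ} {x : V} : x ∈ divBy L c ↔ (c : ℤ) • x ∈ L :=
  Iff.rfl

theorem sup_span_inf_divBy {L M : Submodule ℤ V} {s c : ℕ} (hLM : L ≤ M)
    (hM : ∀ m ∈ M, (s : ℤ) • m ∈ L) (h : s.Coprime c) {x : V} (hx : (c : ℤ) • x ∈ L) :
    (M ⊔ Submodule.span ℤ {x}) ⊓ divBy L c = L ⊔ Submodule.span ℤ {x} := by
  ext y
  rw [Submodule.mem_inf, mem_divBy, mem_sup_span_int, mem_sup_span_int]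
  constructor
  · rintro ⟨⟨m, hm, k, rfl⟩, hy⟩
    refine ⟨m, mem_of_coprime_smul_mem h (hM m hm) ?_, k, rfl⟩
    rw [smul_add, smul_comm] at hy
    exact (L.add_mem_iff_left (L.smul_mem k hx)).1 hy
  · rintro ⟨m, hm, k, rfl⟩
    refine ⟨⟨m, hLM hm, k, rfl⟩, ?_⟩
    rw [smul_add, smul_comm]
    exact L.add_mem (L.smul_mem _ hm) (L.smul_mem k hx)

theorem sup_span_smul {M : Submodule ℤ V} {s c : ℕ} (h : s.Coprime c) {x : V}
    (hx : (c : ℤ) • x ∈ M) :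
    M ⊔ Submodule.span ℤ {(s : ℤ) • x} = M ⊔ Submodule.span ℤ {x} := by
  apply le_antisymm
  · refine sup_le le_sup_left ?_
    rw [Submodule.span_singleton_le_iff_mem]
    exact Submodule.smul_mem _ _ self_mem_sup_span
  · refine sup_le le_sup_left ?_
    rw [Submodule.span_singleton_le_iff_mem]
    exact mem_of_coprime_smul_mem h self_mem_sup_span ((le_sup_left : M ≤ _) hx)

theorem IsCycExt.exists_generator {L M B : Submodule ℤ V} {s c : ℕ}
    (hM : ∀ m ∈ M, (s : ℤ) • m ∈ L) (h : s.Coprime c) (hB : IsCycExt M B c) :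
    ∃ x : V, (c : ℤ) • x ∈ L ∧ B = M ⊔ Submodule.span ℤ {x} ∧
      ∀ n : ℤ, n • x ∈ M ↔ (c : ℤ) ∣ n := by
  obtain ⟨x, rfl, hx⟩ := hB
  have hcx : (c : ℤ) • x ∈ M := (hx c).2 dvd_rfl
  refine ⟨(s : ℤ) • x, ?_, (sup_span_smul h hcx).symm, fun n => ?_⟩
  · rw [smul_comm]
    exact hM _ hcx
  · rw [smul_smul, hx]
    exact ⟨fun hn => (Nat.isCoprime_iff_coprime.2 h.symm).dvd_of_dvd_mul_right hn,
      fun hn => hn.mul_right _⟩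

theorem sup_map_smul_sup_span {L M : Submodule ℤ V} (hLM : L ≤ M) (c : ℕ) (x : V) :
    M ⊔ (L ⊔ Submodule.span ℤ {x}).map (LinearMap.lsmul ℤ V (c : ℤ)) =
      M ⊔ Submodule.span ℤ {(c : ℤ) • x} := by
  rw [Submodule.map_sup, Submodule.map_span, Set.image_singleton, ← sup_assoc]
  congr 1
  refine sup_eq_left.2 ?_
  rintro _ ⟨y, hy, rfl⟩
  exact hLM (L.smul_mem _ hy)

theorem sup_span_sup_span_add {L : Submodule ℤ V} {c₁ c₂ : ℕ} (h : c₁.Coprime c₂) {x₁ x₂ : V}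
    (h₁ : (c₁ : ℤ) • x₁ ∈ L) (h₂ : (c₂ : ℤ) • x₂ ∈ L) :
    (L ⊔ Submodule.span ℤ {x₁}) ⊔ (L ⊔ Submodule.span ℤ {x₂}) =
      L ⊔ Submodule.span ℤ {x₁ + x₂} := by
  set N := L ⊔ Submodule.span ℤ {x₁ + x₂} with hN
  have hL : L ≤ N := le_sup_left
  have hx : x₁ + x₂ ∈ N := self_mem_sup_span
  have e₁ : x₁ ∈ N := by
    refine mem_of_coprime_smul_mem h (hL h₁) ?_
    have := N.smul_mem (c₂ : ℤ) hx
    rw [smul_add] at this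
    exact (N.add_mem_iff_left (hL h₂)).1 this
  have e₂ : x₂ ∈ N := (N.add_mem_iff_right e₁).1 hx
  apply le_antisymm
  · simp only [sup_le_iff, Submodule.span_singleton_le_iff_mem]
    exact ⟨⟨hL, e₁⟩, hL, e₂⟩
  · rw [hN, sup_le_iff, Submodule.span_singleton_le_iff_mem]
    exact ⟨le_sup_left.trans le_sup_left,
      Submodule.add_mem _ ((le_sup_left : L ⊔ Submodule.span ℤ {x₁} ≤ _) self_mem_sup_span)
        ((le_sup_right : L ⊔ Submodule.span ℤ {x₂} ≤ _) self_mem_sup_span)⟩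

theorem HasIndex.unique {T : V →+ V} {X : Submodule ℤ V} {f g : ℕ} (hf : HasIndex T X f)
    (hg : HasIndex T X g) : f = g :=
  Nat.dvd_antisymm (Int.natCast_dvd_natCast.1 ((hf g).1 ((hg g).2 dvd_rfl)))
    (Int.natCast_dvd_natCast.1 ((hg f).1 ((hf f).2 dvd_rfl)))

theorem exists_hasIndex (T : V →+ V) (X : Submodule ℤ V) : ∃ f : ℕ, HasIndex T X f := by
  let I : Ideal ℤ :=
    { carrier := {n | ∀ x ∈ X, n • T x ∈ X}
      add_mem' := fun {m n} hm hn x hx => by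
        rw [add_smul]
        exact X.add_mem (hm x hx) (hn x hx)
      zero_mem' := fun x _ => by
        rw [zero_smul]
        exact X.zero_mem
      smul_mem' := fun m n hn x hx => by
        rw [smul_assoc]
        exact X.smul_mem m (hn x hx) }
  refine ⟨(Submodule.IsPrincipal.generator I).natAbs, fun n => ?_⟩
  rw [Int.natAbs_dvd, ← Submodule.IsPrincipal.mem_iff_generator_dvd I]
  rfl

/-- Indices of commensurable submodules differ by bounded factors. -/
theorem HasIndex.dvd_mul {T : V →+ V} {X Y : Submodule ℤ V} {f g s t : ℕ}
    (hX : HasIndex T X f) (hY : HasIndex T Y g) (hs : ∀ y ∈ Y, (s : ℤ) • y ∈ X)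
    (ht : ∀ x ∈ X, (t : ℤ) • x ∈ Y) : g ∣ s * t * f := by
  have : (g : ℤ) ∣ (s * t * f : ℤ) := by
    refine (hY _).1 fun y hy => ?_
    have h := ht _ ((hX f).2 dvd_rfl _ (hs y hy))
    rw [map_zsmul, smul_smul, smul_smul] at h
    convert h using 2
    ring
  exact_mod_cast this

theorem eq_mul_of_dvd {f f₁ f₂ s₁ s₂ : ℕ} (hs : s₁.Coprime s₂) (hf : f₁.Coprime f₂)
    (h₁ : f₁.Coprime s₂) (h₂ : f₂.Coprime s₁) (d₁ : f₁ ∣ s₂ * f) (d₂ : f₂ ∣ s₁ * f)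
    (e₁ : f ∣ s₂ * f₁) (e₂ : f ∣ s₁ * f₂) : f = f₁ * f₂ := by
  apply Nat.dvd_antisymm
  · have hg := Nat.dvd_gcd e₁ e₂
    have h : Nat.gcd (s₂ * f₁) (s₁ * f₂) ∣ Nat.gcd s₂ (s₁ * f₂) * Nat.gcd f₁ (s₁ * f₂) :=
      Nat.gcd_mul_left_dvd_mul_gcd _ _ _
    rw [Nat.Coprime.gcd_mul_left_cancel_right _ hs, Nat.Coprime.gcd_mul_right_cancel_right _ hf.symm]
      at h
    rw [mul_comm f₁]
    exact hg.trans (h.trans (mul_dvd_mul (Nat.gcd_dvd_right _ _) (Nat.gcd_dvd_left _ _)))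
  · exact hf.mul_dvd_of_dvd_of_dvd (h₁.dvd_of_dvd_mul_left d₁) (h₂.dvd_of_dvd_mul_left d₂)

theorem mul_eq_mul_iff_of_coprime {f₁ f₂ b₁ b₂ : ℕ} (h₁ : f₁.Coprime b₂) (h₂ : b₁.Coprime f₂) :
    f₁ * f₂ = b₁ * b₂ ↔ f₁ = b₁ ∧ f₂ = b₂ := by
  refine ⟨fun h => ⟨?_, ?_⟩, fun ⟨h, h'⟩ => h ▸ h' ▸ rfl⟩
  · exact Nat.dvd_antisymm (h₁.dvd_of_dvd_mul_right (h ▸ dvd_mul_right _ _))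
      (h₂.dvd_of_dvd_mul_right (h ▸ dvd_mul_right _ _))
  · exact Nat.dvd_antisymm (h₂.symm.dvd_of_dvd_mul_left (h ▸ dvd_mul_left _ _))
      (h₁.symm.dvd_of_dvd_mul_left (h ▸ dvd_mul_left _ _))

theorem hasIndex_mul_iff {T : V →+ V} {X M₁ M₂ B₁ B₂ : Submodule ℤ V}
    {a₁ a₂ b₁ b₂ c₁ c₂ : ℕ} (hco : (a₁ * b₁ * c₁).Coprime (a₂ * b₂ * c₂))
    (hM₁ : HasIndex T M₁ a₁) (hM₂ : HasIndex T M₂ a₂) (hMB₁ : M₁ ≤ B₁) (hMB₂ : M₂ ≤ B₂)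
    (hBM₁ : ∀ x ∈ B₁, (c₁ : ℤ) • x ∈ M₁) (hBM₂ : ∀ x ∈ B₂, (c₂ : ℤ) • x ∈ M₂)
    (hXB₁ : ∀ x ∈ X, (c₂ : ℤ) • x ∈ B₁) (hXB₂ : ∀ x ∈ X, (c₁ : ℤ) • x ∈ B₂)
    (hBX₁ : ∀ x ∈ B₁, (a₂ : ℤ) • x ∈ X) (hBX₂ : ∀ x ∈ B₂, (a₁ : ℤ) • x ∈ X) :
    HasIndex T X (b₁ * b₂) ↔ HasIndex T B₁ b₁ ∧ HasIndex T B₂ b₂ := by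
  obtain ⟨f, hf⟩ := exists_hasIndex T X
  obtain ⟨f₁, hf₁⟩ := exists_hasIndex T B₁
  obtain ⟨f₂, hf₂⟩ := exists_hasIndex T B₂
  have k₁ : f₁ ∣ c₁ * a₁ := by
    have := hM₁.dvd_mul hf₁ hBM₁ (t := 1) (fun x hx => B₁.smul_mem _ (hMB₁ hx))
    rwa [mul_one] at this
  have k₂ : f₂ ∣ c₂ * a₂ := by
    have := hM₂.dvd_mul hf₂ hBM₂ (t := 1) (fun x hx => B₂.smul_mem _ (hMB₂ hx))
    rwa [mul_one] at this
  have hco' := hco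
  simp only [Nat.coprime_mul_iff_left, Nat.coprime_mul_iff_right] at hco'
  have hs : (c₁ * a₁).Coprime (c₂ * a₂) := by
    simp only [Nat.coprime_mul_iff_left, Nat.coprime_mul_iff_right]
    tauto
  have hb₁ : (c₁ * a₁).Coprime b₂ := by
    simp only [Nat.coprime_mul_iff_left]
    tauto
  have hb₂ : b₁.Coprime (c₂ * a₂) := by
    simp only [Nat.coprime_mul_iff_right]
    tauto
  have key : f = f₁ * f₂ := by
    refine eq_mul_of_dvd hs (hs.of_dvd k₁ k₂) (hs.of_dvd_left k₁) (hs.symm.of_dvd_left k₂)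
      ?_ ?_ ?_ ?_
    · rw [mul_comm c₂]
      exact hf.dvd_mul hf₁ hBX₁ hXB₁
    · rw [mul_comm c₁]
      exact hf.dvd_mul hf₂ hBX₂ hXB₂
    · exact hf₁.dvd_mul hf hXB₁ hBX₁
    · exact hf₂.dvd_mul hf hXB₂ hBX₂
  have : f₁ * f₂ = b₁ * b₂ ↔ f₁ = b₁ ∧ f₂ = b₂ :=
    mul_eq_mul_iff_of_coprime (hb₁.of_dvd_left k₁) (hb₂.of_dvd_right k₂)
  constructor
  · intro h
    obtain ⟨rfl, rfl⟩ := this.1 (key.symm.trans (hf.unique h))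
    exact ⟨hf₁, hf₂⟩
  · rintro ⟨h₁, h₂⟩
    rw [← hf₁.unique h₁, ← hf₂.unique h₂, ← key]
    exact hf

theorem IsCycExt.smul_mem {L L' : Submodule ℤ V} {c : ℕ} (h : IsCycExt L L' c) {x : V}
    (hx : x ∈ L') : (c : ℤ) • x ∈ L := by
  obtain ⟨g, rfl, hg⟩ := h
  obtain ⟨m, hm, k, rfl⟩ := mem_sup_span_int.1 hx
  rw [smul_add, smul_comm]
  exact L.add_mem (L.smul_mem _ hm) (L.smul_mem _ ((hg c).2 dvd_rfl))

theorem IsCycExt.le {L L' : Submodule ℤ V} {c : ℕ} (h : IsCycExt L L' c) : L ≤ L' := by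
  obtain ⟨g, rfl, -⟩ := h
  exact le_sup_left

theorem isCycExt_one {L L' : Submodule ℤ V} : IsCycExt L L' 1 ↔ L' = L := by
  constructor
  · rintro ⟨x, rfl, hx⟩
    have : x ∈ L := by simpa using (hx 1).2 (by simp)
    rwa [sup_eq_left, Submodule.span_singleton_le_iff_mem]
  · rintro rfl
    exact ⟨0, by simp, by simp⟩

/-- The part of a cyclic extension of order `c₁ * c₂` transported to an overmodule `M`. -/
theorem IsCycExt.sup_map {L M L' : Submodule ℤ V} {s c₁ c₂ : ℕ} (hLM : L ≤ M)
    (hM : ∀ m ∈ M, (s : ℤ) • m ∈ L) (hs : s.Coprime c₁) (hc₂ : c₂ ≠ 0)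
    (h : IsCycExt L L' (c₁ * c₂)) :
    IsCycExt M (M ⊔ L'.map (LinearMap.lsmul ℤ V (c₂ : ℤ))) c₁ := by
  obtain ⟨x, rfl, hx⟩ := h
  have hcx : (c₁ : ℤ) • (c₂ : ℤ) • x ∈ L := by
    rw [smul_smul, hx]
    push_cast
    exact dvd_rfl
  refine ⟨(c₂ : ℤ) • x, sup_map_smul_sup_span hLM c₂ x, fun n => ⟨fun hn => ?_, ?_⟩⟩
  · have h := hM _ hn
    rw [smul_smul, smul_smul, hx] at h
    push_cast at h
    have := Int.dvd_of_mul_dvd_mul_right (by exact_mod_cast hc₂) h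
    exact (Nat.isCoprime_iff_coprime.2 hs.symm).dvd_of_dvd_mul_left this
  · rintro ⟨k, rfl⟩
    rw [mul_comm, mul_smul]
    exact hLM (L.smul_mem _ hcx)

theorem card_isCycExt_mul {T : V →+ V} {L M₁ M₂ : Submodule ℤ V}
    {a₁ a₂ b₁ b₂ c₁ c₂ : ℕ} (hco : (a₁ * b₁ * c₁).Coprime (a₂ * b₂ * c₂))
    (hc₁ : c₁ ≠ 0) (hc₂ : c₂ ≠ 0) (hL₁ : L ≤ M₁) (hL₂ : L ≤ M₂)
    (hML₁ : ∀ m ∈ M₁, (a₂ : ℤ) • m ∈ L) (hML₂ : ∀ m ∈ M₂, (a₁ : ℤ) • m ∈ L)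
    (hM₁ : HasIndex T M₁ a₁) (hM₂ : HasIndex T M₂ a₂) :
    Nat.card {L' : Submodule ℤ V // IsCycExt L L' (c₁ * c₂) ∧ HasIndex T L' (b₁ * b₂)} =
      Nat.card {B : Submodule ℤ V // IsCycExt M₁ B c₁ ∧ HasIndex T B b₁} *
      Nat.card {B : Submodule ℤ V // IsCycExt M₂ B c₂ ∧ HasIndex T B b₂} := by
  have hco' := hco
  simp only [Nat.coprime_mul_iff_left, Nat.coprime_mul_iff_right] at hco'
  have hs₁ : a₂.Coprime c₁ := by rw [Nat.coprime_comm]; tauto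
  have hs₂ : a₁.Coprime c₂ := by tauto
  have hc : c₁.Coprime c₂ := by tauto
  rw [← Nat.card_prod]
  have index_iff : ∀ {L' : Submodule ℤ V}, IsCycExt L L' (c₁ * c₂) →
      (HasIndex T L' (b₁ * b₂) ↔
        HasIndex T (M₁ ⊔ L'.map (LinearMap.lsmul ℤ V (c₂ : ℤ))) b₁ ∧
        HasIndex T (M₂ ⊔ L'.map (LinearMap.lsmul ℤ V (c₁ : ℤ))) b₂) := by
    intro L' h
    have sub : ∀ {M : Submodule ℤ V} {s c : ℕ}, (∀ m ∈ M, (s : ℤ) • m ∈ L) →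
        ∀ x ∈ M ⊔ L'.map (LinearMap.lsmul ℤ V (c : ℤ)), (s : ℤ) • x ∈ L' := by
      intro M s c hM x hx
      obtain ⟨m, hm, _, ⟨y, hy, rfl⟩, rfl⟩ := Submodule.mem_sup.1 hx
      rw [smul_add]
      exact L'.add_mem (h.le (hM m hm)) (L'.smul_mem _ (L'.smul_mem _ hy))
    have e₁ := h.sup_map hL₁ hML₁ hs₁ hc₂
    have e₂ := (mul_comm c₁ c₂ ▸ h).sup_map hL₂ hML₂ hs₂ hc₁
    exact hasIndex_mul_iff hco hM₁ hM₂ e₁.le e₂.le (fun x => e₁.smul_mem) (fun x => e₂.smul_mem)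
      (fun x hx => (le_sup_right : _ ≤ M₁ ⊔ _) ⟨x, hx, rfl⟩)
      (fun x hx => (le_sup_right : _ ≤ M₂ ⊔ _) ⟨x, hx, rfl⟩) (sub hML₁) (sub hML₂)
  have glue : ∀ {B₁ B₂ : Submodule ℤ V}, IsCycExt M₁ B₁ c₁ → IsCycExt M₂ B₂ c₂ →
      IsCycExt L (B₁ ⊓ divBy L c₁ ⊔ B₂ ⊓ divBy L c₂) (c₁ * c₂) ∧
      M₁ ⊔ (B₁ ⊓ divBy L c₁ ⊔ B₂ ⊓ divBy L c₂).map (LinearMap.lsmul ℤ V (c₂ : ℤ)) = B₁ ∧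
      M₂ ⊔ (B₁ ⊓ divBy L c₁ ⊔ B₂ ⊓ divBy L c₂).map (LinearMap.lsmul ℤ V (c₁ : ℤ)) = B₂ := by
    intro B₁ B₂ h₁ h₂
    obtain ⟨x₁, hx₁, rfl, ho₁⟩ := h₁.exists_generator hML₁ hs₁
    obtain ⟨x₂, hx₂, rfl, ho₂⟩ := h₂.exists_generator hML₂ hs₂
    rw [sup_span_inf_divBy hL₁ hML₁ hs₁ hx₁, sup_span_inf_divBy hL₂ hML₂ hs₂ hx₂,
      sup_span_sup_span_add hc hx₁ hx₂, sup_map_smul_sup_span hL₁, sup_map_smul_sup_span hL₂]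
    have absorb : ∀ {M : Submodule ℤ V} {u v : V}, v ∈ M →
        M ⊔ Submodule.span ℤ {u + v} = M ⊔ Submodule.span ℤ {u} := by
      intro M u v hv
      apply le_antisymm <;> rw [sup_le_iff, Submodule.span_singleton_le_iff_mem] <;>
        refine ⟨le_sup_left, ?_⟩
      · exact Submodule.add_mem _ self_mem_sup_span ((le_sup_left : M ≤ _) hv)
      · exact (Submodule.add_mem_iff_left _ ((le_sup_left : M ≤ _) hv)).1 self_mem_sup_span
    refine ⟨⟨x₁ + x₂, rfl, fun n => ⟨fun hn => ?_, ?_⟩⟩, ?_, ?_⟩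
    · push_cast
      rw [smul_add] at hn
      refine (Nat.isCoprime_iff_coprime.2 hc).mul_dvd ?_ ?_
      · have h := L.smul_mem (c₂ : ℤ) hn
        rw [smul_add, smul_comm (c₂ : ℤ) n x₂, L.add_mem_iff_left (L.smul_mem n hx₂),
          smul_smul] at h
        exact (Nat.isCoprime_iff_coprime.2 hc).dvd_of_dvd_mul_left ((ho₁ _).1 (hL₁ h))
      · have h := L.smul_mem (c₁ : ℤ) hn
        rw [smul_add, smul_comm (c₁ : ℤ) n x₁, L.add_mem_iff_right (L.smul_mem n hx₁),
          smul_smul] at h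
        exact (Nat.isCoprime_iff_coprime.2 hc.symm).dvd_of_dvd_mul_left ((ho₂ _).1 (hL₂ h))
    · rintro ⟨k, rfl⟩
      push_cast
      rw [smul_add]
      refine L.add_mem ?_ ?_
      · rw [mul_assoc, mul_comm, mul_smul]
        exact L.smul_mem _ hx₁
      · rw [mul_comm (c₁ : ℤ), mul_assoc, mul_comm, mul_smul]
        exact L.smul_mem _ hx₂
    · rw [smul_add, absorb (hL₁ hx₂), sup_span_smul hc.symm (hL₁ hx₁)]
    · rw [smul_add, add_comm, absorb (hL₂ hx₁), sup_span_smul hc (hL₂ hx₂)]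
  refine Nat.card_congr
    { toFun := fun X =>
        (⟨M₁ ⊔ X.1.map (LinearMap.lsmul ℤ V (c₂ : ℤ)),
            X.2.1.sup_map hL₁ hML₁ hs₁ hc₂, ((index_iff X.2.1).1 X.2.2).1⟩,
          ⟨M₂ ⊔ X.1.map (LinearMap.lsmul ℤ V (c₁ : ℤ)),
            (show IsCycExt L X.1 (c₂ * c₁) from mul_comm c₁ c₂ ▸ X.2.1).sup_map hL₂ hML₂ hs₂ hc₁, ((index_iff X.2.1).1 X.2.2).2⟩)
      invFun := fun B => ⟨B.1.1 ⊓ divBy L c₁ ⊔ B.2.1 ⊓ divBy L c₂, (glue B.1.2.1 B.2.2.1).1, by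
        rw [index_iff (glue B.1.2.1 B.2.2.1).1, (glue B.1.2.1 B.2.2.1).2.1,
          (glue B.1.2.1 B.2.2.1).2.2]
        exact ⟨B.1.2.2, B.2.2.2⟩⟩
      left_inv := ?_
      right_inv := fun B => Prod.ext (Subtype.ext (glue B.1.2.1 B.2.2.1).2.1)
        (Subtype.ext (glue B.1.2.1 B.2.2.1).2.2) }
  rintro ⟨L', ⟨x, rfl, hx⟩, h'⟩
  have hx₁ : (c₁ : ℤ) • (c₂ : ℤ) • x ∈ L := by
    rw [smul_smul, hx]
    push_cast
    exact dvd_rfl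
  have hx₂ : (c₂ : ℤ) • (c₁ : ℤ) • x ∈ L := by rwa [smul_comm]
  apply Subtype.ext
  dsimp only
  rw [sup_map_smul_sup_span hL₁, sup_map_smul_sup_span hL₂,
    sup_span_inf_divBy hL₁ hML₁ hs₁ hx₁, sup_span_inf_divBy hL₂ hML₂ hs₂ hx₂]
  apply le_antisymm
  · simp only [sup_le_iff, Submodule.span_singleton_le_iff_mem, le_sup_left, true_and]
    exact ⟨Submodule.smul_mem _ _ self_mem_sup_span, Submodule.smul_mem _ _ self_mem_sup_span⟩
  · rw [sup_le_iff, Submodule.span_singleton_le_iff_mem]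
    exact ⟨le_sup_left.trans le_sup_left, mem_of_coprime_smul_mem hc
      ((le_sup_right : L ⊔ Submodule.span ℤ {(c₁ : ℤ) • x} ≤ _) self_mem_sup_span)
      ((le_sup_left : L ⊔ Submodule.span ℤ {(c₂ : ℤ) • x} ≤ _) self_mem_sup_span)⟩

end Extensions

section Overmodule

variable {V : Type*} [AddCommGroup V]

/-- Adjoining `a₁ • T L` to `L` reduces the index from `a₁ * a₂` to `a₁`. -/
theorem exists_overmodule_hasIndex {T : V →+ V} {t n : ℤ}
    (hT : ∀ x, T (T x) = t • T x + n • x) {L : Submodule ℤ V} (hL : L.FG) {a₁ a₂ : ℕ}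
    (ha₂ : a₂ ≠ 0) (h : HasIndex T L (a₁ * a₂)) :
    ∃ M : Submodule ℤ V, M.FG ∧ L ≤ M ∧ (∀ m ∈ M, (a₂ : ℤ) • m ∈ L) ∧ HasIndex T M a₁ := by
  let φ : V →ₗ[ℤ] V := (a₁ : ℤ) • T.toIntLinearMap
  have hφ : ∀ x, φ x = (a₁ : ℤ) • T x := fun x => rfl
  have hM : ∀ m ∈ L ⊔ L.map φ, (a₂ : ℤ) • m ∈ L := by
    intro m hm
    obtain ⟨x, hx, _, ⟨y, hy, rfl⟩, rfl⟩ := Submodule.mem_sup.1 hm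
    rw [smul_add, hφ, smul_smul]
    refine L.add_mem (L.smul_mem _ hx) ((h _).2 ?_ y hy)
    push_cast
    rw [mul_comm]
  refine ⟨L ⊔ L.map φ, hL.sup (hL.map _), le_sup_left, hM, fun k => ⟨fun hk => ?_, ?_⟩⟩
  · have : ((a₁ * a₂ : ℕ) : ℤ) ∣ a₂ * k := by
      refine (h _).1 fun x hx => ?_
      rw [mul_smul]
      exact hM _ (hk x ((le_sup_left : L ≤ _) hx))
    push_cast at this
    rw [mul_comm] at this
    exact Int.dvd_of_mul_dvd_mul_left (by exact_mod_cast ha₂) this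
  · rintro ⟨k, rfl⟩ m hm
    obtain ⟨x, hx, _, ⟨y, hy, rfl⟩, rfl⟩ := Submodule.mem_sup.1 hm
    refine Submodule.mem_sup.2 ⟨(a₁ * a₁ * k * n : ℤ) • y, L.smul_mem _ hy,
      φ (k • x + (a₁ * k * t : ℤ) • y), ⟨_, L.add_mem (L.smul_mem _ hx) (L.smul_mem _ hy), rfl⟩, ?_⟩
    simp only [hφ, map_add, map_zsmul, hT]
    module

theorem card_isCycExt_one {T : V →+ V} {L : Submodule ℤ V} {b : ℕ} (h : HasIndex T L b) :
    Nat.card {L' : Submodule ℤ V // IsCycExt L L' 1 ∧ HasIndex T L' b} = 1 := by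
  rw [Nat.card_eq_one_iff_unique]
  refine ⟨⟨fun X Y => Subtype.ext ?_⟩, ⟨⟨L, isCycExt_one.2 rfl, h⟩⟩⟩
  rw [isCycExt_one.1 X.2.1, isCycExt_one.1 Y.2.1]

end Overmodule

section Factorization

theorem finprod_factorization_mul {R : Type*} [CommMonoid R] {r : ℕ → ℕ → ℕ → R}
    (hr : r 1 1 1 = 1) {a₁ b₁ c₁ a₂ b₂ c₂ : ℕ}
    (hco : (a₁ * b₁ * c₁).Coprime (a₂ * b₂ * c₂))
    (h₁ : a₁ * b₁ * c₁ ≠ 0) (h₂ : a₂ * b₂ * c₂ ≠ 0) :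
    ∏ᶠ (p : ℕ) (_ : p.Prime), r (p ^ (a₁ * a₂).factorization p)
        (p ^ (b₁ * b₂).factorization p) (p ^ (c₁ * c₂).factorization p) =
      (∏ᶠ (p : ℕ) (_ : p.Prime), r (p ^ a₁.factorization p) (p ^ b₁.factorization p)
        (p ^ c₁.factorization p)) *
      ∏ᶠ (p : ℕ) (_ : p.Prime), r (p ^ a₂.factorization p) (p ^ b₂.factorization p)
        (p ^ c₂.factorization p) := by
  have triv : ∀ {a b c p : ℕ}, ¬ p ∣ a * b * c → a.factorization p = 0 ∧
      b.factorization p = 0 ∧ c.factorization p = 0 := fun {a b c p} h =>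
    ⟨Nat.factorization_eq_zero_of_not_dvd fun h' => h ((h'.mul_right _).mul_right _),
      Nat.factorization_eq_zero_of_not_dvd fun h' => h ((h'.mul_left _).mul_right _),
      Nat.factorization_eq_zero_of_not_dvd fun h' => h (h'.mul_left _)⟩
  have fin : ∀ {a b c : ℕ}, a * b * c ≠ 0 → ({p : ℕ | p.Prime} ∩ Function.mulSupport
      fun p => r (p ^ a.factorization p) (p ^ b.factorization p)
        (p ^ c.factorization p)).Finite := by
    intro a b c h
    refine (a * b * c).primeFactors.finite_toSet.subset fun p hp => ?_
    simp only [Finset.mem_coe, Nat.mem_primeFactors]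
    refine ⟨hp.1, by_contra fun hn => hp.2 ?_, h⟩
    obtain ⟨ea, eb, ec⟩ := triv hn
    simp [ea, eb, ec, hr]
  refine Eq.trans (finprod_mem_congr rfl fun p hp => ?_)
    (finprod_mem_mul_distrib' (s := {p : ℕ | p.Prime}) (fin h₁) (fin h₂))
  simp only [mul_ne_zero_iff] at h₁ h₂
  rw [Nat.factorization_mul h₁.1.1 h₂.1.1, Nat.factorization_mul h₁.1.2 h₂.1.2,
    Nat.factorization_mul h₁.2 h₂.2]
  simp only [Finsupp.add_apply]
  by_cases hd : p ∣ a₁ * b₁ * c₁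
  · obtain ⟨ea, eb, ec⟩ := triv fun hd' => Nat.not_coprime_of_dvd_of_dvd (Nat.Prime.one_lt hp) hd hd' hco
    simp [ea, eb, ec, hr]
  · obtain ⟨ea, eb, ec⟩ := triv hd
    simp [ea, eb, ec, hr]

theorem finprod_factorization_prime_pow {R : Type*} [CommMonoid R] {r : ℕ → ℕ → ℕ → R}
    (hr : r 1 1 1 = 1) {p : ℕ} (hp : p.Prime) (x y z : ℕ) :
    ∏ᶠ (q : ℕ) (_ : q.Prime), r (q ^ (p ^ x).factorization q)
        (q ^ (p ^ y).factorization q) (q ^ (p ^ z).factorization q) =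
      r (p ^ x) (p ^ y) (p ^ z) := by
  rw [finprod_eq_single _ p fun q hq => ?_]
  · simp [hp]
  · simp [hp.factorization, hq.symm, hr]

end Factorization

section Quotient

variable {K : Type} [Field K]

theorem isCycExt_iff_quotLat {L L' : Submodule ℤ K} {c : ℕ} :
    IsCycExt L L' c ↔
      L ≤ L' ∧ IsAddCyclic (quotLat K L L') ∧ Nat.card (quotLat K L L') = c := by
  have mk_zero : ∀ (x : L') (n : ℤ),
      n • (Submodule.Quotient.mk x : L' ⧸ L.comap L'.subtype) = 0 ↔ n • (x : K) ∈ L := by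
    intro x n
    rw [← Submodule.Quotient.mk_smul, Submodule.Quotient.mk_eq_zero]
    rfl
  have gen : ∀ x : L', L ≤ L' →
      ((∀ y : L' ⧸ L.comap L'.subtype, y ∈ AddSubgroup.zmultiples
        (Submodule.Quotient.mk x : L' ⧸ L.comap L'.subtype)) ↔
      L' = L ⊔ Submodule.span ℤ {(x : K)}) := by
    intro x hL
    constructor
    · intro h
      apply le_antisymm
      · intro y hy
        obtain ⟨k, hk⟩ := h (Submodule.Quotient.mk ⟨y, hy⟩)
        simp only at hk
        rw [← Submodule.Quotient.mk_smul, eq_comm, Submodule.Quotient.eq] at hk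
        exact mem_sup_span_int.2 ⟨_, hk, k, by simp⟩
      · rw [sup_le_iff, Submodule.span_singleton_le_iff_mem]
        exact ⟨hL, x.2⟩
    · intro h y
      obtain ⟨⟨y, hy⟩, rfl⟩ := Submodule.Quotient.mk_surjective _ y
      have hy' := hy
      rw [h] at hy'
      obtain ⟨m, hm, k, e⟩ := mem_sup_span_int.1 hy'
      refine ⟨k, ?_⟩
      simp only
      rw [← Submodule.Quotient.mk_smul, eq_comm, Submodule.Quotient.eq]
      change y - k • (x : K) ∈ L
      rw [← e, add_sub_cancel_right]
      exact hm
  constructor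
  · rintro ⟨x, h, hx⟩
    have hL : L ≤ L' := h ▸ le_sup_left
    have hx' : x ∈ L' := h ▸ self_mem_sup_span
    have hg := (gen ⟨x, hx'⟩ hL).2 h
    refine ⟨hL, ⟨⟨_, hg⟩⟩, ?_⟩
    have hcard := addOrderOf_eq_card_of_forall_mem_zmultiples hg
    change Nat.card (L' ⧸ L.comap L'.subtype) = c
    rw [← hcard]
    refine Nat.dvd_antisymm ?_ ?_ <;> rw [← Int.natCast_dvd_natCast]
    · rw [addOrderOf_dvd_iff_zsmul_eq_zero, mk_zero, hx]
    · rw [← hx, ← mk_zero ⟨x, hx'⟩, ← addOrderOf_dvd_iff_zsmul_eq_zero]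
  · rintro ⟨hL, ⟨⟨g, hg⟩⟩, hc⟩
    obtain ⟨x, rfl⟩ := Submodule.Quotient.mk_surjective _ g
    refine ⟨x, (gen x hL).1 hg, fun n => ?_⟩
    have hcard := addOrderOf_eq_card_of_forall_mem_zmultiples hg
    rw [← mk_zero, ← hc, ← addOrderOf_dvd_iff_zsmul_eq_zero]
    exact iff_of_eq (congrArg (fun m : ℕ => (m : ℤ) ∣ n) hcard)

end Quotient

section Quadratic

variable {K : Type} [Field K] [NumberField K]

/-- The ring of integers of a quadratic field is `ℤ + ℤω` for some irrational `ω`. -/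
theorem exists_integral_generator_s14 (hdeg : Module.finrank ℚ K = 2) :
    ∃ ω : NumberField.RingOfIntegers K,
      (∀ y : NumberField.RingOfIntegers K, ∃ m n : ℤ, y = m + n * ω) ∧
      ∀ m n : ℤ, (m + n * ω : NumberField.RingOfIntegers K) = 0 → n = 0 := by
  have hrank : Module.finrank ℤ (NumberField.RingOfIntegers K) = 2 :=
    (NumberField.RingOfIntegers.rank K).trans hdeg
  let b := Module.finBasisOfFinrankEq ℤ (NumberField.RingOfIntegers K) hrank
  have hb : ∀ y, (b.repr y 0 : NumberField.RingOfIntegers K) * b 0 + b.repr y 1 * b 1 = y := by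
    intro y
    have := b.sum_repr y
    simpa [Fin.sum_univ_two, zsmul_eq_mul] using this
  obtain ⟨u, hu⟩ : ∃ u, u = b.repr 1 0 := ⟨_, rfl⟩
  obtain ⟨v, hv⟩ : ∃ v, v = b.repr 1 1 := ⟨_, rfl⟩
  have huv : (u : NumberField.RingOfIntegers K) * b 0 + v * b 1 = 1 := by
    rw [hu, hv]
    exact hb 1
  have hcop : IsCoprime u v := by
    rw [Int.isCoprime_iff_gcd_eq_one]
    obtain ⟨g, hg⟩ : ∃ g : ℤ, g = Int.gcd u v := ⟨_, rfl⟩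
    obtain ⟨u', hu'⟩ : g ∣ u := hg ▸ Int.gcd_dvd_left u v
    obtain ⟨v', hv'⟩ : g ∣ v := hg ▸ Int.gcd_dvd_right u v
    have h1 : algebraMap ℤ (NumberField.RingOfIntegers K) g *
        (u' * b 0 + v' * b 1) = 1 := by
      rw [← huv, eq_intCast, hu', hv']
      push_cast
      ring
    have h2 := congrArg (Algebra.norm ℤ) h1
    rw [map_mul, Algebra.norm_algebraMap_of_basis b, MonoidHom.map_one] at h2
    have h3 : IsUnit g := by
      refine IsUnit.of_mul_eq_one (g * Algebra.norm ℤ (u' * b 0 + v' * b 1)) ?_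
      rw [← h2, Fintype.card_fin]
      ring
    rw [hg] at h3
    simpa using Int.isUnit_iff_natAbs_eq.1 h3
  obtain ⟨s, t, hst⟩ := hcop
  have hst' : (s : NumberField.RingOfIntegers K) * u + t * v = 1 := by exact_mod_cast hst
  refine ⟨-t * b 0 + s * b 1, fun y => ?_, fun m n h => ?_⟩
  · refine ⟨b.repr y 0 * s + b.repr y 1 * t, -(b.repr y 0) * v + b.repr y 1 * u, ?_⟩
    conv_lhs => rw [← hb y]
    push_cast
    linear_combination (-(b.repr y 0 : NumberField.RingOfIntegers K) * b 0 -
      (b.repr y 1) * b 1) * hst' + ((b.repr y 0 : NumberField.RingOfIntegers K) * s +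
      b.repr y 1 * t) * huv
  · have key : (m * u - n * t) • b 0 + (m * v + n * s) • b 1 = 0 := by
      simp only [zsmul_eq_mul]
      push_cast
      linear_combination h + (m : NumberField.RingOfIntegers K) * huv
    have li := Fintype.linearIndependent_iff.1 b.linearIndependent
      ![m * u - n * t, m * v + n * s] (by simpa [Fin.sum_univ_two] using key)
    have h₀ : m * u - n * t = 0 := li 0
    have h₁ : m * v + n * s = 0 := li 1
    linear_combination (-n) * hst + u * h₁ - v * h₀

theorem hasCond_iff_hasIndex {ω : NumberField.RingOfIntegers K}
    (hω : ∀ y : NumberField.RingOfIntegers K, ∃ m n : ℤ, y = m + n * ω)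
    (hω' : ∀ m n : ℤ, (m + n * ω : NumberField.RingOfIntegers K) = 0 → n = 0)
    {X : Submodule ℤ K} (hX : IsLat K X) {c : ℕ} (hc : 0 < c) :
    HasCond K X c ↔ HasIndex (AddMonoidHom.mulLeft (ω : K)) X c := by
  have mem_mult : ∀ m n : ℤ, (m : K) + n * ω ∈ multLat K X ↔
      ∀ x ∈ X, n • AddMonoidHom.mulLeft (ω : K) x ∈ X := by
    intro m n
    refine forall₂_congr fun x hx => ?_
    rw [add_mul, ← zsmul_eq_mul, X.add_mem_iff_right (X.smul_mem m hx), mul_assoc, ← zsmul_eq_mul]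
    rfl
  have mem_order : ∀ m n : ℤ, (m : K) + n * ω ∈ orderSet K c ↔ (c : ℤ) ∣ n := by
    intro m n
    constructor
    · rintro ⟨a, y, h⟩
      obtain ⟨m', n', rfl⟩ := hω y
      have h0 : ((m - a - c * m' : ℤ) + (n - c * n' : ℤ) * ω :
          NumberField.RingOfIntegers K) = 0 := by
        apply FaithfulSMul.algebraMap_injective (NumberField.RingOfIntegers K) K
        push_cast at h ⊢
        simp only [map_intCast] at h ⊢
        linear_combination h
      exact ⟨n', by linarith [hω' _ _ h0]⟩
    · rintro ⟨k, rfl⟩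
      refine ⟨m, k * ω, ?_⟩
      simp [mul_assoc]
  have exists_rep : ∀ x : K, IsIntegral ℤ x → ∃ m n : ℤ, x = m + n * ω := by
    intro x hx
    obtain ⟨m, n, h⟩ := hω ⟨x, hx⟩
    refine ⟨m, n, ?_⟩
    have : x = algebraMap (NumberField.RingOfIntegers K) K (m + n * ω) :=
      congrArg (algebraMap (NumberField.RingOfIntegers K) K) h
    rw [this]
    simp
  have hbot : X ≠ ⊥ := by
    rintro rfl
    have := hX.2
    simp at this
  constructor
  · rintro ⟨-, h⟩ n
    rw [← mem_mult 0 n, ← mem_order 0 n, ← h]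
    rfl
  · refine fun h => ⟨hc, Set.ext fun x => ⟨fun hx => ?_, fun hx => ?_⟩⟩
    · obtain ⟨m, n, rfl⟩ := exists_rep x (isIntegral_of_smul_mem_submodule X hbot hX.1 x hx)
      exact (mem_order m n).2 ((h n).1 ((mem_mult m n).1 hx))
    · obtain ⟨m, n, rfl⟩ := exists_rep x (by
        obtain ⟨a, y, rfl⟩ := hx
        simpa using NumberField.RingOfIntegers.isIntegral_coe
          (a + c * y : NumberField.RingOfIntegers K))
      exact (mem_mult m n).2 ((h n).2 ((mem_order m n).1 hx))

theorem IsCycExt.isLat {L L' : Submodule ℤ K} {c : ℕ} (h : IsCycExt L L' c) (hL : IsLat K L) :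
    IsLat K L' := by
  obtain ⟨x, rfl, -⟩ := h
  exact ⟨hL.1.sup (Submodule.fg_span_singleton x),
    top_le_iff.1 (hL.2.ge.trans (Submodule.span_mono (le_sup_left : L ≤ _)))⟩

theorem cnt_eq_card {ω : NumberField.RingOfIntegers K}
    (hω : ∀ y : NumberField.RingOfIntegers K, ∃ m n : ℤ, y = m + n * ω)
    (hω' : ∀ m n : ℤ, (m + n * ω : NumberField.RingOfIntegers K) = 0 → n = 0)
    {L : Submodule ℤ K} (hL : IsLat K L) {b : ℕ} (hb : 0 < b) (c : ℕ) :
    cnt K L b c = Nat.card {L' : Submodule ℤ K //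
      IsCycExt L L' c ∧ HasIndex (AddMonoidHom.mulLeft (ω : K)) L' b} := by
  refine Nat.card_congr (Equiv.subtypeEquivRight fun L' => ⟨?_, ?_⟩)
  · rintro ⟨h₁, h₂, h₃, h₄, h₅⟩
    exact ⟨isCycExt_iff_quotLat.2 ⟨h₁, h₃, h₄⟩, (hasCond_iff_hasIndex hω hω' h₂ hb).1 h₅⟩
  · rintro ⟨h, h'⟩
    obtain ⟨h₁, h₃, h₄⟩ := isCycExt_iff_quotLat.1 h
    exact ⟨h₁, h.isLat hL, h₃, h₄, (hasCond_iff_hasIndex hω hω' (h.isLat hL) hb).2 h'⟩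

/-- Splitting of the count along a coprime factorization of all three arguments. -/
theorem exists_cnt_mul {ω : NumberField.RingOfIntegers K}
    (hω : ∀ y : NumberField.RingOfIntegers K, ∃ m n : ℤ, y = m + n * ω)
    (hω' : ∀ m n : ℤ, (m + n * ω : NumberField.RingOfIntegers K) = 0 → n = 0)
    {a₁ a₂ b₁ b₂ c₁ c₂ : ℕ} (hco : (a₁ * b₁ * c₁).Coprime (a₂ * b₂ * c₂))
    (h₁ : a₁ * b₁ * c₁ ≠ 0) (h₂ : a₂ * b₂ * c₂ ≠ 0)
    {L : Submodule ℤ K} (hL : IsLat K L) (hcond : HasCond K L (a₁ * a₂)) :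
    ∃ M₁ M₂ : Submodule ℤ K, IsLat K M₁ ∧ HasCond K M₁ a₁ ∧ IsLat K M₂ ∧ HasCond K M₂ a₂ ∧
      cnt K L (b₁ * b₂) (c₁ * c₂) = cnt K M₁ b₁ c₁ * cnt K M₂ b₂ c₂ := by
  simp only [mul_ne_zero_iff] at h₁ h₂
  obtain ⟨⟨ha₁, hb₁⟩, hc₁⟩ := h₁
  obtain ⟨⟨ha₂, hb₂⟩, hc₂⟩ := h₂
  obtain ⟨n, t, hnt⟩ := hω (ω * ω)
  have hnt' : (ω : K) * ω = n + t * ω := by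
    have := congrArg (algebraMap (NumberField.RingOfIntegers K) K) hnt
    simpa using this
  have hT : ∀ x : K, AddMonoidHom.mulLeft (ω : K) (AddMonoidHom.mulLeft (ω : K) x) =
      t • AddMonoidHom.mulLeft (ω : K) x + n • x := by
    intro x
    simp only [AddMonoidHom.coe_mulLeft, zsmul_eq_mul]
    linear_combination x * hnt'
  have hidx := (hasCond_iff_hasIndex hω hω' hL hcond.1).1 hcond
  obtain ⟨M₁, hM₁, hL₁, hML₁, hi₁⟩ := exists_overmodule_hasIndex hT hL.1 ha₂ hidx
  obtain ⟨M₂, hM₂, hL₂, hML₂, hi₂⟩ := exists_overmodule_hasIndex hT hL.1 ha₁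
    (mul_comm a₁ a₂ ▸ hidx)
  have lat : ∀ {M : Submodule ℤ K}, M.FG → L ≤ M → IsLat K M := fun hM h =>
    ⟨hM, top_le_iff.1 (hL.2.ge.trans (Submodule.span_mono h))⟩
  have l₁ := lat hM₁ hL₁
  have l₂ := lat hM₂ hL₂
  refine ⟨M₁, M₂, l₁, (hasCond_iff_hasIndex hω hω' l₁ (by lia)).2 hi₁, l₂,
    (hasCond_iff_hasIndex hω hω' l₂ (by lia)).2 hi₂, ?_⟩
  rw [cnt_eq_card hω hω' hL (by positivity), cnt_eq_card hω hω' l₁ (by lia),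
    cnt_eq_card hω hω' l₂ (by lia)]
  exact card_isCycExt_mul hco hc₁ hc₂ hL₁ hL₂ hML₁ hML₂ hi₁ hi₂

end Quadratic

/-- The counting function `r_K(a, b, c)` is multiplicative:
`r_K(a, b, c) = ∏_p r_K(p^{v_p(a)}, p^{v_p(b)}, p^{v_p(c)})`. -/
theorem cnt_multiplicative
    (hdeg : Module.finrank ℚ K = 2)
    (himag : IsEmpty (K →+* ℝ))
    (a b c : ℕ) (ha : 0 < a) (hb : 0 < b) (hc : 0 < c)
    (L : Submodule ℤ K) (hL : IsLat K L) (hcond : HasCond K L a)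
    (r : ℕ → ℕ → ℕ → ℕ)
    (hr : ∀ p : ℕ, p.Prime → ∀ x y z : ℕ, ∀ M : Submodule ℤ K,
      IsLat K M → HasCond K M (p ^ x) →
        cnt K M (p ^ y) (p ^ z) = r (p ^ x) (p ^ y) (p ^ z)) :
    cnt K L b c = ∏ᶠ (p : ℕ) (_ : p.Prime),
      r (p ^ a.factorization p) (p ^ b.factorization p) (p ^ c.factorization p) := by
  obtain ⟨ω, hω, hω'⟩ := exists_integral_generator_s14 hdeg
  have hr1 : r 1 1 1 = 1 := by
    obtain ⟨M, -, hM, hM1, -⟩ := exists_cnt_mul (a₁ := 1) (a₂ := a) (b₁ := 1) (b₂ := 1) (c₁ := 1)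
      (c₂ := 1) hω hω' (by simp) (by simp) (by simpa using ha.ne') hL (by simpa using hcond)
    have h := hr 2 Nat.prime_two 0 0 0 M hM (by simpa using hM1)
    simp only [pow_zero] at h
    rw [← h, cnt_eq_card hω hω' hM one_pos]
    exact card_isCycExt_one ((hasCond_iff_hasIndex hω hω' hM one_pos).1 hM1)
  suffices H : ∀ N : ℕ, N ≠ 0 → ∀ a b c : ℕ, a * b * c ∣ N → ∀ L : Submodule ℤ K,
      IsLat K L → HasCond K L a → cnt K L b c = ∏ᶠ (p : ℕ) (_ : p.Prime),
        r (p ^ a.factorization p) (p ^ b.factorization p) (p ^ c.factorization p) from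
    H (a * b * c) (by positivity) a b c dvd_rfl L hL hcond
  clear! a b c L
  intro N
  induction N using Nat.recOnPrimeCoprime with
  | zero => exact fun h => absurd rfl h
  | prime_pow p k hp =>
    intro _ a b c hd L hL hcond
    obtain ⟨x, -, rfl⟩ := (Nat.dvd_prime_pow hp).1
      ((Dvd.intro _ (mul_assoc a b c).symm).trans hd)
    obtain ⟨y, -, rfl⟩ := (Nat.dvd_prime_pow hp).1
      (((Dvd.intro_left _ rfl).mul_right c).trans hd)
    obtain ⟨z, -, rfl⟩ := (Nat.dvd_prime_pow hp).1 ((Dvd.intro_left _ rfl).trans hd)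
    rw [finprod_factorization_prime_pow hr1 hp]
    exact hr p hp x y z L hL hcond
  | coprime m n hm hn hmn ihm ihn =>
    intro h0 a b c hd L hL hcond
    obtain ⟨a₁, a₂, ha₁, ha₂, rfl⟩ := Nat.dvd_mul.1
      ((Dvd.intro _ (mul_assoc a b c).symm).trans hd)
    obtain ⟨b₁, b₂, hb₁, hb₂, rfl⟩ := Nat.dvd_mul.1
      (((Dvd.intro_left _ rfl).mul_right c).trans hd)
    obtain ⟨c₁, c₂, hc₁, hc₂, rfl⟩ := Nat.dvd_mul.1 ((Dvd.intro_left _ rfl).trans hd)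
    have hd₁ : a₁ * b₁ * c₁ ∣ m :=
      (((hmn.of_dvd_left ha₁).mul_left (hmn.of_dvd_left hb₁)).mul_left
        (hmn.of_dvd_left hc₁)).dvd_of_dvd_mul_right (Dvd.dvd.trans ⟨a₂ * b₂ * c₂, by ring⟩ hd)
    have hd₂ : a₂ * b₂ * c₂ ∣ n :=
      (((hmn.symm.of_dvd_left ha₂).mul_left (hmn.symm.of_dvd_left hb₂)).mul_left
        (hmn.symm.of_dvd_left hc₂)).dvd_of_dvd_mul_left
          (Dvd.dvd.trans ⟨a₁ * b₁ * c₁, by ring⟩ hd)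
    have hm₀ : m ≠ 0 := by lia
    have hn₀ : n ≠ 0 := by lia
    have h₁ := ne_zero_of_dvd_ne_zero hm₀ hd₁
    have h₂ := ne_zero_of_dvd_ne_zero hn₀ hd₂
    have hco := hmn.of_dvd hd₁ hd₂
    obtain ⟨M₁, M₂, l₁, k₁, l₂, k₂, h⟩ := exists_cnt_mul hω hω' hco h₁ h₂ hL hcond
    rw [h, finprod_factorization_mul hr1 hco h₁ h₂, ihm hm₀ a₁ b₁ c₁ hd₁ M₁ l₁ k₁,
      ihn hn₀ a₂ b₂ c₂ hd₂ M₂ l₂ k₂]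

end
end

section
/- Let K be an imaginary quadratic field whose only roots of unity are ±1. For every positive integer m, the Picard group of the order O_m satisfies #Pic(O_m) = h · ∏_{p ∣ m} p^{v_p(m) − 1}·(p − χ_K(p)), the product over the distinct primes p dividing m, where v_p is the p-adic valuation and h is the class number of K (equivalently, #Pic(O_m) = h·m·∏_{p ∣ m}(1 − χ_K(p)/p)). -/
noncomputable section

variable (K : Type) [Field K] [NumberField K]

/-- The order `ℤ + m·O_K` of conductor `m`, as a subring of `K`. -/
def orderSubring (m : ℕ) : Subring K where
  carrier := orderSet K m
  add_mem' := by
    rintro x y ⟨a, u, rfl⟩ ⟨b, v, rfl⟩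
    exact ⟨a + b, u + v, by rw [map_add]; push_cast; ring⟩
  zero_mem' := ⟨0, 0, by simp⟩
  one_mem' := ⟨1, 0, by simp⟩
  neg_mem' := by
    rintro x ⟨a, u, rfl⟩
    exact ⟨-a, -u, by rw [map_neg]; push_cast; ring⟩
  mul_mem' := by
    rintro x y ⟨a, u, rfl⟩ ⟨b, v, rfl⟩
    refine ⟨a * b, a • v + b • u + (m : ℤ) • (u * v), ?_⟩
    rw [map_add, map_add, map_zsmul, map_zsmul, map_zsmul, map_mul]
    rw [zsmul_eq_mul, zsmul_eq_mul, zsmul_eq_mul]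
    push_cast
    ring

/-- The rational prime `p` splits in `K`. -/
def SplitsIn (p : ℕ) : Prop :=
  ∃ P Q : Ideal (NumberField.RingOfIntegers K), P.IsPrime ∧ Q.IsPrime ∧ P ≠ Q ∧
    Ideal.span {(p : NumberField.RingOfIntegers K)} = P * Q

/-- The rational prime `p` ramifies in `K`. -/
def RamifiesIn (p : ℕ) : Prop :=
  ∃ P : Ideal (NumberField.RingOfIntegers K), P.IsPrime ∧
    Ideal.span {(p : NumberField.RingOfIntegers K)} = P ^ 2

/-- The rational prime `p` is inert in `K`. -/
def InertIn (p : ℕ) : Prop :=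
  (Ideal.span {(p : NumberField.RingOfIntegers K)}).IsPrime

section Picard

open CommRing

section Conductor

variable {R S : Type*} [CommRing R] [CommRing S] [Algebra R S]

theorem exists_mem_algebraMap_eq_mul_of_mem_map {f : Ideal S}
    (hf : ∀ c ∈ f, ∃ r : R, algebraMap R S r = c) {L : Ideal R} {y : S}
    (hy : y ∈ L.map (algebraMap R S)) :
    ∀ c ∈ f, ∃ r ∈ L, algebraMap R S r = y * c := by
  induction hy using Submodule.span_induction with
  | mem y hy =>
    rintro c hc
    obtain ⟨l, hl, rfl⟩ := hy
    obtain ⟨r, rfl⟩ := hf c hc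
    exact ⟨l * r, L.mul_mem_right _ hl, map_mul ..⟩
  | zero => exact fun c _ ↦ ⟨0, L.zero_mem, by simp⟩
  | add y z _ _ hy hz =>
    intro c hc
    obtain ⟨a, ha, ha'⟩ := hy c hc
    obtain ⟨b, hb, hb'⟩ := hz c hc
    exact ⟨a + b, L.add_mem ha hb, by rw [map_add, ha', hb', add_mul]⟩
  | smul s y _ hy =>
    intro c hc
    obtain ⟨a, ha, ha'⟩ := hy (s * c) (f.mul_mem_left _ hc)
    exact ⟨a, ha, by rw [ha', smul_eq_mul]; ring⟩

theorem comap_map_eq_of_sup_comap_eq_top [FaithfulSMul R S] {f : Ideal S}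
    (hf : ∀ c ∈ f, ∃ r : R, algebraMap R S r = c) {L : Ideal R}
    (hL : L ⊔ f.comap (algebraMap R S) = ⊤) :
    (L.map (algebraMap R S)).comap (algebraMap R S) = L := by
  refine le_antisymm (fun x hx ↦ ?_) Ideal.le_comap_map
  obtain ⟨l, hl, c, hc, h⟩ := Submodule.mem_sup.mp ((Ideal.eq_top_iff_one _).mp hL)
  obtain ⟨r, hr, hr'⟩ := exists_mem_algebraMap_eq_mul_of_mem_map hf hx _ hc
  rw [← map_mul] at hr'
  rw [← mul_one x, ← h, mul_add, ← FaithfulSMul.algebraMap_injective R S hr']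
  exact L.add_mem (L.mul_mem_left _ hl) hr

theorem comap_sup_comap_eq_top {f : Ideal S}
    (hf : ∀ c ∈ f, ∃ r : R, algebraMap R S r = c) {J : Ideal S} (hJ : J ⊔ f = ⊤) :
    J.comap (algebraMap R S) ⊔ f.comap (algebraMap R S) = ⊤ := by
  obtain ⟨j, hj, c, hc, h⟩ := Submodule.mem_sup.mp ((Ideal.eq_top_iff_one _).mp hJ)
  obtain ⟨r, rfl⟩ := hf c hc
  refine (Ideal.eq_top_iff_one _).mpr (Submodule.mem_sup.mpr ⟨1 - r, ?_, r, hc, by ring⟩)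
  rwa [Ideal.mem_comap, map_sub, map_one, ← h, add_sub_cancel_right]

theorem map_comap_eq_of_sup_eq_top {f : Ideal S}
    (hf : ∀ c ∈ f, ∃ r : R, algebraMap R S r = c) {J : Ideal S} (hJ : J ⊔ f = ⊤) :
    (J.comap (algebraMap R S)).map (algebraMap R S) = J := by
  refine le_antisymm Ideal.map_comap_le fun x hx ↦ ?_
  obtain ⟨j, hj, c, hc, h⟩ := Submodule.mem_sup.mp
    ((Ideal.eq_top_iff_one _).mp (comap_sup_comap_eq_top hf hJ))
  obtain ⟨r, hr⟩ := hf (x * algebraMap R S c) (f.mul_mem_left _ hc)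
  rw [← mul_one x, ← map_one (algebraMap R S), ← h, map_add, mul_add]
  refine add_mem (Ideal.mul_mem_left _ _ (Ideal.mem_map_of_mem _ hj)) ?_
  rw [← hr]
  refine Ideal.mem_map_of_mem _ ?_
  rw [Ideal.mem_comap, hr]
  exact J.mul_mem_right _ hx

theorem exists_ne_zero_mem_one_sub_mem {f J : Ideal S} [Nontrivial S] (hJ : J ≠ ⊥)
    (h : J ⊔ f = ⊤) : ∃ n ∈ J, n ≠ 0 ∧ 1 - n ∈ f := by
  by_cases hf : f = ⊤
  · obtain ⟨n, hn, hn0⟩ := J.ne_bot_iff.mp hJ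
    exact ⟨n, hn, hn0, hf ▸ Submodule.mem_top⟩
  · obtain ⟨j, hj, c, hc, h⟩ := Submodule.mem_sup.mp ((Ideal.eq_top_iff_one _).mp h)
    refine ⟨j, hj, ?_, ?_⟩
    · rintro rfl
      exact hf ((Ideal.eq_top_iff_one _).mpr (by rwa [← h, zero_add]))
    · rwa [← h, add_sub_cancel_left]

theorem invertible_of_mul_eq_span_singleton [IsDomain R] {I I' : Ideal R} {n : R} (hn : n ≠ 0)
    (h : I * I' = Ideal.span {n}) : Module.Invertible R I := by
  let F := FractionRing R
  have hu : IsUnit (I : FractionalIdeal (nonZeroDivisors R) F) := by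
    refine isUnit_of_mul_isUnit_left (y := (I' : FractionalIdeal (nonZeroDivisors R) F)) ?_
    rw [← FractionalIdeal.coeIdeal_mul, h, FractionalIdeal.coeIdeal_span_singleton]
    have hn' : algebraMap R F n ≠ 0 := by simpa using hn
    exact IsUnit.of_mul_eq_one _ (FractionalIdeal.spanSingleton_mul_inv F hn')
  let U := FractionalIdeal.unitsMulEquivSubmodule hu.unit
  have e : I ≃ₗ[R] (U : Submodule R F) :=
    Submodule.equivMapOfInjective (Algebra.linearMap R F) (IsFractionRing.injective R F) I
  exact .congr e.symm

theorem invertible_comap [IsDomain R] [IsDedekindDomain S] [FaithfulSMul R S] {f : Ideal S}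
    (hf : ∀ c ∈ f, ∃ r : R, algebraMap R S r = c) {J : Ideal S} (hJ₀ : J ≠ ⊥) (hJ : J ⊔ f = ⊤) :
    Module.Invertible R (J.comap (algebraMap R S)) := by
  obtain ⟨n, hnJ, hn, hnf⟩ := exists_ne_zero_mem_one_sub_mem hJ₀ hJ
  obtain ⟨J', hJ'⟩ := Ideal.dvd_span_singleton.mpr hnJ
  obtain ⟨r, hr⟩ := hf _ hnf
  obtain rfl : algebraMap R S (1 - r) = n := by rw [map_sub, hr, map_one]; ring
  have hJ'f : J' ⊔ f = ⊤ := by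
    refine (Ideal.eq_top_iff_one _).mpr (Submodule.mem_sup.mpr ⟨_, ?_, _, hnf, add_sub_cancel ..⟩)
    exact Ideal.dvd_span_singleton.mp ⟨J, by rw [hJ', mul_comm]⟩
  refine invertible_of_mul_eq_span_singleton (I' := J'.comap (algebraMap R S)) (n := 1 - r)
    (by rintro h; simp [h] at hn) ?_
  rw [← comap_map_eq_of_sup_comap_eq_top hf (L := _ * _), Ideal.map_mul,
    map_comap_eq_of_sup_eq_top hf hJ, map_comap_eq_of_sup_eq_top hf hJ'f, ← hJ',
    ← Set.image_singleton, ← Ideal.map_span, comap_map_eq_of_sup_comap_eq_top hf]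
  · refine (Ideal.eq_top_iff_one _).mpr (Submodule.mem_sup.mpr ⟨1 - r,
      Ideal.mem_span_singleton_self _, r, ?_, sub_add_cancel ..⟩)
    rw [Ideal.mem_comap, hr]; exact hnf
  · exact Ideal.isCoprime_iff_sup_eq.mp <|
      (Ideal.isCoprime_iff_sup_eq.mpr (comap_sup_comap_eq_top hf hJ)).mul_left
        (Ideal.isCoprime_iff_sup_eq.mpr (comap_sup_comap_eq_top hf hJ'f))

/-- Multiplication by a nonzero element identifies an ideal of a domain with a multiple of it. -/
theorem nonempty_linearEquiv_span_singleton_mul [IsDomain S] {a : S} (ha : a ≠ 0) (J : Ideal S) :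
    Nonempty (J ≃ₗ[S] (Ideal.span {a} * J : Ideal S)) := by
  refine ⟨Submodule.equivMapOfInjective (LinearMap.mulLeft S a)
    (fun x y h ↦ mul_left_cancel₀ ha h) J ≪≫ₗ .ofEq _ _ ?_⟩
  ext x
  simp [Ideal.mem_span_singleton_mul]

theorem exists_linearEquiv_sup_eq_top [IsDedekindDomain S] {f J : Ideal S} (hf : f ≠ ⊥)
    (hJ : J ≠ ⊥) : ∃ J' : Ideal S, J' ≠ ⊥ ∧ J' ⊔ f = ⊤ ∧ Nonempty (J ≃ₗ[S] J') := by
  by_cases hft : f = ⊤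
  · exact ⟨J, hJ, by simp [hft], ⟨.refl ..⟩⟩
  obtain ⟨d, hd, hd0⟩ := J.ne_bot_iff.mp hJ
  obtain ⟨B, hB⟩ := Ideal.dvd_span_singleton.mpr hd
  have hB0 : B ≠ ⊥ := by
    rintro rfl
    simp [hd0] at hB
  obtain ⟨a, ha⟩ := IsDedekindDomain.exists_sup_span_eq (I := B * f) (J := B)
    Ideal.mul_le_left (mul_ne_zero hB0 hf)
  obtain ⟨J', hJ'⟩ := Ideal.dvd_span_singleton.mpr (ha ▸ Ideal.mem_sup_right
    (Ideal.mem_span_singleton_self a) : a ∈ B)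
  have htop : J' ⊔ f = ⊤ := by
    rw [hJ', ← Ideal.mul_sup, sup_comm] at ha
    exact mul_left_cancel₀ hB0 (ha.trans (Ideal.mul_top B).symm)
  have hJ'0 : J' ≠ ⊥ := by
    rintro rfl
    exact hft (by simpa using htop)
  have ha0 : a ≠ 0 := by
    rintro rfl
    rw [Ideal.span_singleton_zero, eq_comm] at hJ'
    exact (mul_ne_zero hB0 hJ'0) hJ'
  obtain ⟨e⟩ := nonempty_linearEquiv_span_singleton_mul ha0 J
  obtain ⟨e'⟩ := nonempty_linearEquiv_span_singleton_mul hd0 J'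
  refine ⟨J', hJ'0, htop, ⟨e ≪≫ₗ .ofEq _ _ ?_ ≪≫ₗ e'.symm⟩⟩
  rw [hJ', hB]; ring

end Conductor

theorem mapAlgebra_surjective_of_conductor {R S : Type*} [CommRing R] [CommRing S] [Algebra R S]
    [IsDomain R] [IsDedekindDomain S] [FaithfulSMul R S]
    {f : Ideal S} (hf₀ : f ≠ ⊥) (hf : ∀ c ∈ f, ∃ r : R, algebraMap R S r = c) :
    Function.Surjective (Pic.mapAlgebra R S) := by
  intro x
  obtain ⟨J, ⟨e⟩⟩ := Module.Invertible.exists_linearEquiv_ideal S x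
  have hJ : J ≠ ⊥ := by
    rintro rfl
    have := Module.Invertible.congr e
    obtain ⟨s, hs⟩ := exists_ne (0 : S)
    exact hs (FaithfulSMul.eq_of_smul_eq_smul (M := S) (α := (⊥ : Ideal S))
      fun _ ↦ Subsingleton.elim _ _)
  obtain ⟨J', hJ', htop, ⟨e'⟩⟩ := exists_linearEquiv_sup_eq_top hf₀ hJ
  have := invertible_comap hf hJ' htop
  have := Module.Invertible.congr (e ≪≫ₗ e')
  let l : (J'.comap (algebraMap R S)) →ₗ[R] J' :=
    { toFun i := ⟨algebraMap R S i, i.2⟩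
      map_add' _ _ := by ext; simp
      map_smul' _ _ := by ext; simp [Algebra.smul_def] }
  have hl : Function.Surjective (l.liftBaseChange S) := by
    rw [← LinearMap.range_eq_top, eq_top_iff, ← Submodule.map_le_map_iff_of_injective
      J'.subtype_injective, Submodule.map_top, Submodule.range_subtype]
    conv_lhs => rw [← map_comap_eq_of_sup_eq_top hf htop]
    refine Ideal.map_le_iff_le_comap.mpr fun i hi ↦ ?_
    exact ⟨l ⟨i, hi⟩, ⟨1 ⊗ₜ ⟨i, hi⟩, by simp⟩, rfl⟩
  refine ⟨Pic.mk R (J'.comap (algebraMap R S)), ?_⟩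
  rw [Pic.mapAlgebra_apply]
  exact Pic.mk_eq_iff.mpr ⟨TensorProduct.AlgebraTensorModule.congr (.refl S S)
    (Pic.mk.linearEquiv R (J'.comap (algebraMap R S))) ≪≫ₗ
    .ofBijective _ (Module.Invertible.bijective_of_surjective hl) ≪≫ₗ (e ≪≫ₗ e').symm⟩

section ConductorQuotient

variable {R S : Type*} [CommRing R] [CommRing S] [Algebra R S]

/-- The preimage in `S` of the `R`-submodule of `S ⧸ f` generated by `u`. -/
def conductorSpan (R : Type*) [CommRing R] [Algebra R S] (f : Ideal S) (u : S ⧸ f) :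
    Submodule R S :=
  (Submodule.span R {u}).comap (Ideal.Quotient.mkₐ R f).toLinearMap

theorem mem_conductorSpan {f : Ideal S} {u : S ⧸ f} {x : S} :
    x ∈ conductorSpan R f u ↔ ∃ r : R, r • u = Ideal.Quotient.mk f x := by
  simp [conductorSpan, Submodule.mem_span_singleton]

theorem mem_conductorSpan_of_mem {f : Ideal S} {c : S} (hc : c ∈ f) (u : S ⧸ f) :
    c ∈ conductorSpan R f u :=
  mem_conductorSpan.mpr ⟨0, by rw [zero_smul, Ideal.Quotient.eq_zero_iff_mem.mpr hc]⟩

theorem conductorSpan_mul {f : Ideal S} {u : S ⧸ f} (hu : IsUnit u) (v : S ⧸ f) :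
    conductorSpan R f (u * v) = conductorSpan R f u * conductorSpan R f v := by
  apply le_antisymm
  · obtain ⟨u', hu'⟩ := hu.exists_right_inv
    obtain ⟨a, rfl⟩ := Ideal.Quotient.mk_surjective u
    obtain ⟨a', rfl⟩ := Ideal.Quotient.mk_surjective u'
    obtain ⟨b, rfl⟩ := Ideal.Quotient.mk_surjective v
    have ha : a ∈ conductorSpan R f (Ideal.Quotient.mk f a) :=
      mem_conductorSpan.mpr ⟨1, one_smul ..⟩
    have hb : b ∈ conductorSpan R f (Ideal.Quotient.mk f b) :=
      mem_conductorSpan.mpr ⟨1, one_smul ..⟩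
    have hc : 1 - a * a' ∈ f := by
      rw [← Ideal.Quotient.eq_zero_iff_mem, map_sub, map_mul, hu', map_one, sub_self]
    have hf : ∀ z ∈ f, z ∈ conductorSpan R f (Ideal.Quotient.mk f a) *
        conductorSpan R f (Ideal.Quotient.mk f b) := fun z hz ↦ by
      rw [show z = a * (a' * z) + (1 - a * a') * z by ring]
      exact add_mem (Submodule.mul_mem_mul ha (mem_conductorSpan_of_mem (f.mul_mem_left _ hz) _))
        (Submodule.mul_mem_mul (mem_conductorSpan_of_mem hc _) (mem_conductorSpan_of_mem hz _))
    intro x hx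
    obtain ⟨r, hr⟩ := mem_conductorSpan.mp hx
    rw [← sub_add_cancel x (r • (a * b))]
    refine add_mem (hf _ ?_) (Submodule.smul_mem _ _ (Submodule.mul_mem_mul ha hb))
    rw [← Ideal.Quotient.eq_zero_iff_mem, map_sub, ← hr, ← map_mul, sub_eq_zero]
    exact (map_smul (Ideal.Quotient.mkₐ R f) r (a * b)).symm
  · refine Submodule.mul_le.mpr fun x hx y hy ↦ ?_
    obtain ⟨r, hr⟩ := mem_conductorSpan.mp hx
    obtain ⟨s, hs⟩ := mem_conductorSpan.mp hy
    exact mem_conductorSpan.mpr ⟨r * s, by rw [map_mul, ← hr, ← hs, smul_mul_smul_comm]⟩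

theorem conductorSpan_one {f : Ideal S} (hf : ∀ c ∈ f, ∃ r : R, algebraMap R S r = c) :
    conductorSpan R f 1 = 1 := by
  ext x
  rw [mem_conductorSpan, Submodule.mem_one]
  constructor
  · rintro ⟨r, hr⟩
    obtain ⟨s, hs⟩ := hf (x - algebraMap R S r) <| by
      rw [← Ideal.Quotient.eq_zero_iff_mem, map_sub, ← hr, Algebra.smul_def, mul_one, sub_eq_zero]
      rfl
    exact ⟨s + r, by rw [map_add, hs, sub_add_cancel]⟩
  · rintro ⟨r, rfl⟩
    exact ⟨r, by rw [Algebra.smul_def, mul_one]; rfl⟩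

/-- Units modulo an ideal `f` of `S` contained in `R` give invertible `R`-submodules of `S`. -/
def conductorUnitsHom (f : Ideal S) (hf : ∀ c ∈ f, ∃ r : R, algebraMap R S r = c) :
    (S ⧸ f)ˣ →* (Submodule R S)ˣ where
  toFun u := ⟨conductorSpan R f u, conductorSpan R f ↑u⁻¹,
    by rw [← conductorSpan_mul u.isUnit, u.mul_inv, conductorSpan_one hf],
    by rw [← conductorSpan_mul u⁻¹.isUnit, u.inv_mul, conductorSpan_one hf]⟩
  map_one' := Units.ext (conductorSpan_one hf)
  map_mul' u v := Units.ext (conductorSpan_mul u.isUnit v)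

theorem conductorUnitsHom_eq_one_iff {f : Ideal S}
    (hf : ∀ c ∈ f, ∃ r : R, algebraMap R S r = c) {u : (S ⧸ f)ˣ} :
    conductorUnitsHom f hf u = 1 ↔ (∃ r : R, algebraMap R (S ⧸ f) r = u) ∧
      ∃ r : R, algebraMap R (S ⧸ f) r = ↑u⁻¹ := by
  have key₁ : ∀ w : (S ⧸ f)ˣ, conductorUnitsHom f hf w = 1 →
      ∃ r : R, algebraMap R (S ⧸ f) r = w := by
    intro w h
    rw [Units.ext_iff] at h
    obtain ⟨a, ha⟩ := Ideal.Quotient.mk_surjective (w : S ⧸ f)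
    have : a ∈ (conductorUnitsHom f hf w : Submodule R S) :=
      mem_conductorSpan.mpr ⟨1, by rw [ha, one_smul]⟩
    rw [h, Units.val_one, Submodule.mem_one] at this
    obtain ⟨r, rfl⟩ := this
    exact ⟨r, ha⟩
  have key₂ : ∀ w : (S ⧸ f)ˣ, (∃ r : R, algebraMap R (S ⧸ f) r = w) →
      (conductorUnitsHom f hf w : Submodule R S) ≤ 1 := by
    rintro w ⟨r, hr⟩
    rw [← conductorSpan_one hf]
    intro x hx
    obtain ⟨s, hs⟩ := mem_conductorSpan.mp hx
    refine mem_conductorSpan.mpr ⟨s * r, ?_⟩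
    rw [← hs, ← hr, Algebra.smul_def, Algebra.smul_def, map_mul, mul_one]
  refine ⟨fun h ↦ ⟨key₁ u h, key₁ _ (by rw [map_inv, h, inv_one])⟩,
    fun ⟨h, h'⟩ ↦ Units.ext (le_antisymm (key₂ u h) ?_)⟩
  calc (1 : Submodule R S) = conductorUnitsHom f hf u * conductorUnitsHom f hf u⁻¹ := by
        rw [← Units.val_mul, ← map_mul, mul_inv_cancel, map_one, Units.val_one]
    _ ≤ conductorUnitsHom f hf u * 1 := mul_le_mul_right (key₂ _ h') _
    _ = _ := mul_one _

theorem exists_mem_mul_sub_intCast_mem {f : Ideal S} {m : ℕ}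
    (hR : ∀ r : R, ∃ a : ℤ, algebraMap R S r - a ∈ f) (hm : ∀ a : ℤ, (a : S) ∈ f → (m : ℤ) ∣ a)
    (I : (Submodule R S)ˣ) (T : Finset ℕ) (hT : ∀ p ∈ T, p.Prime ∧ p ∣ m) :
    ∃ x ∈ (I : Submodule R S), ∃ y ∈ (↑I⁻¹ : Submodule R S), ∃ k : ℤ, x * y - k ∈ f ∧
      ∀ p ∈ T, ¬ (p : ℤ) ∣ k := by
  classical
  have hmul : ∀ x ∈ (I : Submodule R S), ∀ y ∈ (↑I⁻¹ : Submodule R S),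
      ∃ k : ℤ, x * y - k ∈ f := fun x hx y hy ↦ by
    have := Submodule.mul_mem_mul hx hy
    rw [I.mul_inv, Submodule.mem_one] at this
    obtain ⟨r, hr⟩ := this
    exact hr ▸ hR r
  have hprime : ∀ p : ℕ, p.Prime → p ∣ m → ∃ x ∈ (I : Submodule R S),
      ∃ y ∈ (↑I⁻¹ : Submodule R S), ∃ k : ℤ, x * y - k ∈ f ∧ ¬ (p : ℤ) ∣ k := by
    intro p hp hpm
    by_contra! h
    have : ∀ z ∈ (I * ↑I⁻¹ : Submodule R S), ∃ k : ℤ, z - (p * k : ℤ) ∈ f := by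
      intro z hz
      induction hz using Submodule.mul_induction_on' with
      | mem_mul_mem x hx y hy =>
        obtain ⟨k, hk⟩ := hmul x hx y hy
        obtain ⟨l, rfl⟩ := h x hx y hy k hk
        exact ⟨l, hk⟩
      | add x hx y hy ihx ihy =>
        obtain ⟨k, hk⟩ := ihx
        obtain ⟨l, hl⟩ := ihy
        refine ⟨k + l, ?_⟩
        convert f.add_mem hk hl using 1
        push_cast
        ring
    obtain ⟨k, hk⟩ := this 1 (by rw [I.mul_inv]; exact Submodule.one_le.mp le_rfl)
    have h1 := hm (1 - p * k) (by exact_mod_cast hk)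
    have h2 : (p : ℤ) ∣ 1 :=
      (dvd_sub_left (dvd_mul_right _ k)).mp ((Int.natCast_dvd_natCast.mpr hpm).trans h1)
    exact hp.one_lt.ne' (Nat.dvd_one.mp (by exact_mod_cast h2))
  induction T using Finset.induction_on with
  | empty =>
    exact ⟨0, zero_mem _, 0, zero_mem _, 0, by simp, by simp⟩
  | insert p T hpT ih =>
    obtain ⟨hp, hpm⟩ := hT p (Finset.mem_insert_self ..)
    obtain ⟨x, hx, y, hy, k, hk, hkT⟩ := ih fun q hq ↦ hT q (Finset.mem_insert_of_mem hq)
    obtain ⟨x', hx', y', hy', k', hk', hkp⟩ := hprime p hp hpm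
    obtain ⟨a, ha⟩ := hmul x hx y' hy'
    obtain ⟨b, hb⟩ := hmul x' hx' y hy
    set N : ℕ := ∏ q ∈ T, q with hN
    refine ⟨p • x + N • x', add_mem (nsmul_mem hx _) (nsmul_mem hx' _),
      p • y + N • y', add_mem (nsmul_mem hy _) (nsmul_mem hy' _),
      p * p * k + p * N * (a + b) + N * N * k', ?_, ?_⟩
    · convert f.add_mem (f.add_mem (f.mul_mem_left (p * p) hk) (f.mul_mem_left (p * N) ha))
        (f.add_mem (f.mul_mem_left (p * N) hb) (f.mul_mem_left (N * N) hk')) using 1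
      simp only [nsmul_eq_mul]
      push_cast
      ring
    · intro q hq hdvd
      rcases Finset.mem_insert.mp hq with rfl | hqT
      · have hqN : ¬ q ∣ N := by
          rw [hN, hp.prime.dvd_finsetProd_iff]
          rintro ⟨r, hr, hqr⟩
          rw [(Nat.prime_dvd_prime_iff_eq hp (hT r (Finset.mem_insert_of_mem hr)).1).mp hqr] at hpT
          exact hpT hr
        have hq' := Nat.prime_iff_prime_int.mp hp
        rw [show (q * q * k + q * N * (a + b) + N * N * k' : ℤ) =
          q * (q * k + N * (a + b)) + N * N * k' by ring,
          dvd_add_right (dvd_mul_right ..), hq'.dvd_mul, hq'.dvd_mul] at hdvd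
        rcases hdvd with (h | h) | h
        · exact hqN (Int.natCast_dvd_natCast.mp h)
        · exact hqN (Int.natCast_dvd_natCast.mp h)
        · exact hkp h
      · have hqp := (hT q (Finset.mem_insert_of_mem hqT)).1
        have hq' := Nat.prime_iff_prime_int.mp hqp
        obtain ⟨c, hc⟩ : q ∣ N := Finset.dvd_prod_of_mem _ hqT
        have hqp' : ¬ (q : ℤ) ∣ p := fun h ↦ hpT <| by
          rwa [← (Nat.prime_dvd_prime_iff_eq hqp hp).mp (Int.natCast_dvd_natCast.mp h)]
        rw [show (p * p * k + p * N * (a + b) + N * N * k' : ℤ) =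
          q * (p * c * (a + b) + c * N * k') + p * p * k by rw [hc]; push_cast; ring,
          dvd_add_right (dvd_mul_right ..), hq'.dvd_mul, hq'.dvd_mul] at hdvd
        rcases hdvd with (h | h) | h
        · exact hqp' h
        · exact hqp' h
        · exact hkT q hqT h

theorem le_units_of_conductor {f : Ideal S} (hf : ∀ c ∈ f, ∃ r : R, algebraMap R S r = c)
    (I : (Submodule R S)ˣ) : f.restrictScalars R ≤ (I : Submodule R S) := by
  calc f.restrictScalars R = f.restrictScalars R * ↑I⁻¹ * I := by
        rw [mul_assoc, I.inv_mul, mul_one]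
    _ ≤ 1 * I := by
        refine mul_le_mul_left (Submodule.mul_le.mpr fun c hc y _ ↦ ?_) _
        exact Submodule.mem_one.mpr (hf _ (f.mul_mem_right y hc))
    _ = I := one_mul _

theorem conductorUnitsHom_surjective {f : Ideal S}
    (hf : ∀ c ∈ f, ∃ r : R, algebraMap R S r = c) {m : ℕ} (hm0 : m ≠ 0) (hmf : (m : S) ∈ f)
    (hR : ∀ r : R, ∃ a : ℤ, algebraMap R S r - a ∈ f) (hm : ∀ a : ℤ, (a : S) ∈ f → (m : ℤ) ∣ a) :
    Function.Surjective (conductorUnitsHom f hf) := by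
  intro I
  obtain ⟨x, hx, y, hy, k, hk, hkm⟩ := exists_mem_mul_sub_intCast_mem hR hm I m.primeFactors
    fun p hp ↦ ⟨Nat.prime_of_mem_primeFactors hp, Nat.dvd_of_mem_primeFactors hp⟩
  have hcop : IsCoprime k (m : ℤ) := by
    rw [Int.isCoprime_iff_gcd_eq_one]
    refine Nat.coprime_of_dvd fun p hp hpk hpm ↦ ?_
    exact hkm p (Nat.mem_primeFactors.mpr ⟨hp, by simpa using hpm, hm0⟩)
      (Int.natCast_dvd.mpr hpk)
  obtain ⟨l, n, hln⟩ := hcop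
  have hunit : 1 - x * (l * y) ∈ f := by
    have hln' : (l * k + n * m : S) = 1 := by exact_mod_cast congrArg (Int.cast : ℤ → S) hln
    convert f.sub_mem (f.mul_mem_left (n : S) hmf) (f.mul_mem_left (l : S) hk) using 1
    rw [← hln']
    ring
  have huv : Ideal.Quotient.mk f x * Ideal.Quotient.mk f (l * y) = 1 := by
    rw [← map_mul, ← map_one (Ideal.Quotient.mk f), eq_comm]
    exact Ideal.Quotient.eq.mpr hunit
  refine ⟨Units.mkOfMulEqOne _ _ huv, Units.ext ?_⟩
  change conductorSpan R f (Ideal.Quotient.mk f x) = I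
  ext z
  rw [mem_conductorSpan]
  constructor
  · rintro ⟨r, hr⟩
    rw [← sub_add_cancel z (r • x)]
    refine add_mem (le_units_of_conductor hf I ?_) (Submodule.smul_mem _ _ hx)
    rw [Submodule.restrictScalars_mem]
    exact Ideal.Quotient.eq.mp (hr.symm.trans (map_smul (Ideal.Quotient.mkₐ R f) r x).symm)
  · intro hz
    have := Submodule.mul_mem_mul hz hy
    rw [I.mul_inv, Submodule.mem_one] at this
    obtain ⟨r, hr⟩ := this
    refine ⟨l * r, ((map_smul (Ideal.Quotient.mkₐ R f) (l * r) x).symm.trans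
      (Ideal.Quotient.eq.mpr ?_))⟩
    rw [← neg_mem_iff]
    convert f.mul_mem_left z hunit using 1
    rw [Algebra.smul_def, map_mul, hr, map_intCast]
    ring

theorem card_units_submodule_mul_totient {f : Ideal S}
    (hf : ∀ c ∈ f, ∃ r : R, algebraMap R S r = c) {m : ℕ} (hm0 : m ≠ 0) (hmf : (m : S) ∈ f)
    (hR : ∀ r : R, ∃ a : ℤ, algebraMap R S r - a ∈ f) (hm : ∀ a : ℤ, (a : S) ∈ f → (m : ℤ) ∣ a) :
    Nat.card (Submodule R S)ˣ * m.totient = Nat.card (S ⧸ f)ˣ := by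
  have : CharP (S ⧸ f) m := ⟨fun a ↦ by
    rw [← map_natCast (Ideal.Quotient.mk f), Ideal.Quotient.eq_zero_iff_mem]
    refine ⟨fun h ↦ by exact_mod_cast hm a (by exact_mod_cast h), ?_⟩
    rintro ⟨b, rfl⟩
    rw [Nat.cast_mul]
    exact f.mul_mem_right _ hmf⟩
  have : NeZero m := ⟨hm0⟩
  let g : ZMod m →+* S ⧸ f := ZMod.castHom dvd_rfl _
  have hg : Function.Injective g := ZMod.castHom_injective _
  have hRg : ∀ r : R, ∃ a : ZMod m, g a = algebraMap R (S ⧸ f) r := fun r ↦ by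
    obtain ⟨a, ha⟩ := hR r
    exact ⟨a, by rw [map_intCast]; exact (Ideal.Quotient.eq.mpr ha).symm⟩
  have hker : (conductorUnitsHom f hf).ker = (Units.map (g : ZMod m →* S ⧸ f)).range := by
    ext u
    rw [MonoidHom.mem_ker, conductorUnitsHom_eq_one_iff]
    constructor
    · rintro ⟨⟨r, hr⟩, r', hr'⟩
      obtain ⟨a, ha⟩ := hRg r
      obtain ⟨b, hb⟩ := hRg r'
      have hab : a * b = 1 := hg (by rw [map_mul, ha, hb, hr, hr', u.mul_inv, map_one])
      exact ⟨Units.mkOfMulEqOne a b hab, Units.ext (ha.trans hr)⟩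
    · rintro ⟨a, rfl⟩
      have : ∀ a : ZMod m, ∃ r : R, algebraMap R (S ⧸ f) r = g a := fun a ↦ by
        obtain ⟨a, rfl⟩ := ZMod.intCast_surjective a
        exact ⟨a, by rw [map_intCast, map_intCast]⟩
      exact ⟨this a, this ↑a⁻¹⟩
  have h1 := Subgroup.card_mul_index (conductorUnitsHom f hf).ker
  rw [Subgroup.index_ker, MonoidHom.range_eq_top.mpr (conductorUnitsHom_surjective hf hm0 hmf hR hm),
    Subgroup.card_top, hker, ← Nat.card_congr (MonoidHom.ofInjective
      (Units.map_injective (f := (g : ZMod m →* S ⧸ f)) hg)).toEquiv,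
    Nat.card_eq_fintype_card, ZMod.card_units_eq_totient] at h1
  rw [← h1, mul_comm]

end ConductorQuotient

theorem card_pic_eq_mul_card_units_submodule {R S : Type*} [CommRing R] [CommRing S] [Algebra R S]
    [FaithfulSMul R S] (hsurj : Function.Surjective (Pic.mapAlgebra R S))
    (hunits : ∀ u : Sˣ, ∃ r : Rˣ, algebraMap R S r = u) :
    Nat.card (Pic R) = Nat.card (Pic S) * Nat.card (Submodule R S)ˣ := by
  have hinj : Function.Injective (Submodule.unitsToPic R S) := by
    rw [← MonoidHom.ker_eq_bot_iff, Submodule.ker_unitsToPic, eq_bot_iff]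
    rintro _ ⟨u, rfl⟩
    obtain ⟨r, hr⟩ := hunits u
    exact Units.ext (Submodule.span_singleton_eq_one_iff.mpr ⟨r, hr.symm⟩)
  have h := Subgroup.card_mul_index (Pic.mapAlgebra R S).ker
  rw [Subgroup.index_ker, MonoidHom.range_eq_top.mpr hsurj, Subgroup.card_top] at h
  rw [← h, mul_comm, Nat.card_congr (MonoidHom.ofInjective hinj).toEquiv,
    Submodule.range_unitsToPic]
  rfl

section Counting

theorem card_units_eq_mul_card_ker {A B : Type*} [CommRing A] [CommRing B] (f : A →+* B)
    (hf : Function.Surjective f) (hker : RingHom.ker f ≤ nilradical A) :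
    Nat.card Aˣ = Nat.card Bˣ * Nat.card (RingHom.ker f) := by
  have hsurj : Function.Surjective (Units.map (f : A →* B)) := by
    intro u
    obtain ⟨a, ha⟩ := hf u
    obtain ⟨b, hb⟩ := hf ↑u⁻¹
    have hab : IsUnit (a * b) := by
      have : a * b - 1 ∈ RingHom.ker f := by
        rw [RingHom.mem_ker, map_sub, map_mul, ha, hb, u.mul_inv, map_one, sub_self]
      simpa using IsNilpotent.isUnit_add_one (hker this)
    exact ⟨(isUnit_of_mul_isUnit_left hab).unit, Units.ext ha⟩
  let e : (Units.map (f : A →* B)).ker ≃ RingHom.ker f :=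
    { toFun u := ⟨(u : Aˣ) - 1, by
        have := congrArg Units.val (MonoidHom.mem_ker.mp u.2)
        rw [RingHom.mem_ker, map_sub, map_one, sub_eq_zero]
        exact this⟩
      invFun x := ⟨(IsNilpotent.isUnit_add_one (hker x.2)).unit, by
        refine Units.ext ?_
        have := RingHom.mem_ker.mp x.2
        simp [this]⟩
      left_inv u := by ext; simp
      right_inv x := by ext; simp }
  have h := Subgroup.card_mul_index (Units.map (f : A →* B)).ker
  rw [Subgroup.index_ker, MonoidHom.range_eq_top.mpr hsurj, Subgroup.card_top] at h
  rw [← h, mul_comm, Nat.card_congr e]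

theorem card_units_quotient_mul {S : Type*} [CommRing S] {I J : Ideal S} (h : IsCoprime I J) :
    Nat.card (S ⧸ I * J)ˣ = Nat.card (S ⧸ I)ˣ * Nat.card (S ⧸ J)ˣ := by
  rw [Nat.card_congr ((Units.mapEquiv
    (Ideal.quotientMulEquivQuotientProd I J h).toMulEquiv).trans MulEquiv.prodUnits).toEquiv,
    Nat.card_prod]

/-- If every element of `J` is nilpotent modulo `I ≤ J`, then units modulo `J` lift to units
modulo `I`. -/
theorem card_units_quotient_mul_card_quotient {S : Type*} [CommRing S] {I J : Ideal S} (hIJ : I ≤ J)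
    (hrad : J ≤ I.radical) :
    Nat.card (S ⧸ I)ˣ * Nat.card (S ⧸ J) = Nat.card (S ⧸ J)ˣ * Nat.card (S ⧸ I) := by
  have hker : RingHom.ker (Ideal.Quotient.factor hIJ) ≤ nilradical (S ⧸ I) := by
    intro x hx
    obtain ⟨x, rfl⟩ := Ideal.Quotient.mk_surjective x
    rw [RingHom.mem_ker, Ideal.Quotient.factor_mk, Ideal.Quotient.eq_zero_iff_mem] at hx
    obtain ⟨n, hn⟩ := hrad hx
    exact ⟨n, by rw [← map_pow]; exact Ideal.Quotient.eq_zero_iff_mem.mpr hn⟩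
  have hcard : Nat.card (S ⧸ I) =
      Nat.card (RingHom.ker (Ideal.Quotient.factor hIJ)) * Nat.card (S ⧸ J) := by
    have h := AddSubgroup.card_mul_index (Ideal.Quotient.factor hIJ).toAddMonoidHom.ker
    have hr : (Ideal.Quotient.factor hIJ).toAddMonoidHom.range = ⊤ :=
      AddMonoidHom.range_eq_top.mpr (Ideal.Quotient.factor_surjective hIJ)
    rw [AddSubgroup.index_ker, hr, AddSubgroup.card_top] at h
    exact h.symm
  rw [card_units_eq_mul_card_ker _ (Ideal.Quotient.factor_surjective hIJ) hker, hcard, mul_assoc]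

end Counting

section Quadratic
open NumberField

variable {L : Type*} [Field L] [NumberField L]

theorem card_quotient_span_natCast (n : ℕ) :
    Nat.card (𝓞 L ⧸ Ideal.span {(n : 𝓞 L)}) = n ^ Module.finrank ℚ L := by
  rw [← Submodule.cardQuot_apply, ← Ideal.absNorm_apply, Ideal.absNorm_span_natCast,
    RingOfIntegers.rank]

theorem card_units_quotient_span_natCast (hdeg : Module.finrank ℚ L = 2) {m : ℕ} (hm : m ≠ 0)
    {c : ℕ → ℕ} (hc : ∀ p, p.Prime → p ∣ m →
      Nat.card (𝓞 L ⧸ Ideal.span {(p : 𝓞 L)})ˣ = (p - 1) * c p) :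
    Nat.card (𝓞 L ⧸ Ideal.span {(m : 𝓞 L)})ˣ =
      m.totient * ∏ p ∈ m.primeFactors, p ^ (m.factorization p - 1) * c p := by
  have hmul := Nat.multiplicative_factorization
    (fun n ↦ Nat.card (𝓞 L ⧸ Ideal.span {(n : 𝓞 L)})ˣ) (fun x y hxy ↦ by
      rw [Nat.cast_mul, ← Ideal.span_singleton_mul_span_singleton, card_units_quotient_mul]
      rw [Ideal.isCoprime_span_singleton_iff]
      simpa using (Nat.isCoprime_iff_coprime.mpr hxy).map (Int.castRingHom (𝓞 L)))
    (by
      have : Subsingleton (𝓞 L ⧸ Ideal.span {((1 : ℕ) : 𝓞 L)}) := by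
        rw [Ideal.Quotient.subsingleton_iff]; simp
      exact Nat.card_unique) hm
  rw [hmul, Nat.totient_eq_prod_factorization hm, Finsupp.prod, Finsupp.prod,
    Nat.support_factorization, ← Finset.prod_mul_distrib]
  refine Finset.prod_congr rfl fun p hp ↦ ?_
  have hpp := Nat.prime_of_mem_primeFactors hp
  have hpm := Nat.dvd_of_mem_primeFactors hp
  obtain ⟨k, hk⟩ : ∃ k, m.factorization p = k + 1 :=
    Nat.exists_eq_succ_of_ne_zero (hpp.factorization_pos_of_dvd hm hpm).ne'
  have h := card_units_quotient_mul_card_quotient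
    (I := Ideal.span {((p ^ (k + 1) : ℕ) : 𝓞 L)}) (J := Ideal.span {(p : 𝓞 L)})
    (by rw [Ideal.span_singleton_le_span_singleton]; exact ⟨p ^ k, by push_cast; ring⟩)
    (by
      rw [Ideal.span_singleton_le_iff_mem]
      exact ⟨k + 1, by push_cast; exact Ideal.mem_span_singleton_self _⟩)
  rw [card_quotient_span_natCast, card_quotient_span_natCast, hdeg, hc p hpp hpm] at h
  have hp2 : 0 < p ^ 2 := pow_pos hpp.pos 2
  rw [hk, Nat.add_sub_cancel]
  refine Nat.eq_of_mul_eq_mul_right hp2 (h.trans ?_)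
  ring

theorem card_units_quotient_of_isPrime {P : Ideal (𝓞 L)} (hP : P.IsPrime) (hP0 : P ≠ ⊥) :
    Nat.card (𝓞 L ⧸ P)ˣ = Nat.card (𝓞 L ⧸ P) - 1 := by
  have := hP.isMaximal hP0
  let := Ideal.Quotient.field P
  have : Finite (𝓞 L ⧸ P) := Ideal.finiteQuotientOfFreeOfNeBot P hP0
  exact Nat.card_units _

theorem card_quotient_of_span_eq_mul (hdeg : Module.finrank ℚ L = 2) {p : ℕ} (hp : p.Prime)
    {P Q : Ideal (𝓞 L)} (hP : P.IsPrime) (hQ : Q.IsPrime)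
    (h : Ideal.span {(p : 𝓞 L)} = P * Q) :
    Nat.card (𝓞 L ⧸ P) = p ∧ Nat.card (𝓞 L ⧸ Q) = p ∧ P ≠ ⊥ ∧ Q ≠ ⊥ := by
  have hmul := congrArg Ideal.absNorm h
  rw [map_mul, Ideal.absNorm_span_natCast, RingOfIntegers.rank, hdeg, eq_comm,
    Nat.Prime.mul_eq_prime_sq_iff hp (mt Ideal.absNorm_eq_one_iff.mp hP.ne_top)
      (mt Ideal.absNorm_eq_one_iff.mp hQ.ne_top)] at hmul
  refine ⟨by rw [← hmul.1]; rfl, by rw [← hmul.2]; rfl, ?_, ?_⟩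
  · rintro rfl
    exact hp.ne_zero (by simpa using hmul.1.symm)
  · rintro rfl
    exact hp.ne_zero (by simpa using hmul.2.symm)

theorem card_units_quotient_of_split (hdeg : Module.finrank ℚ L = 2) {p : ℕ} (hp : p.Prime)
    {P Q : Ideal (𝓞 L)} (hP : P.IsPrime) (hQ : Q.IsPrime) (hPQ : P ≠ Q)
    (h : Ideal.span {(p : 𝓞 L)} = P * Q) :
    Nat.card (𝓞 L ⧸ Ideal.span {(p : 𝓞 L)})ˣ = (p - 1) * (p - 1) := by
  obtain ⟨hPp, hQp, hP0, hQ0⟩ := card_quotient_of_span_eq_mul hdeg hp hP hQ h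
  rw [h, card_units_quotient_mul, card_units_quotient_of_isPrime hP hP0,
    card_units_quotient_of_isPrime hQ hQ0, hPp, hQp]
  rw [Ideal.isCoprime_iff_sup_eq]
  exact (hP.isMaximal hP0).coprime_of_ne (hQ.isMaximal hQ0) hPQ

theorem card_units_quotient_of_ramified (hdeg : Module.finrank ℚ L = 2) {p : ℕ} (hp : p.Prime)
    {P : Ideal (𝓞 L)} (hP : P.IsPrime) (h : Ideal.span {(p : 𝓞 L)} = P ^ 2) :
    Nat.card (𝓞 L ⧸ Ideal.span {(p : 𝓞 L)})ˣ = (p - 1) * p := by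
  obtain ⟨hPp, -, hP0, -⟩ := card_quotient_of_span_eq_mul hdeg hp hP hP (h.trans (sq P))
  have hcard := card_units_quotient_mul_card_quotient (I := Ideal.span {(p : 𝓞 L)}) (J := P)
    (h ▸ Ideal.pow_le_self two_ne_zero) fun x hx ↦ ⟨2, h ▸ Ideal.pow_mem_pow hx 2⟩
  rw [card_units_quotient_of_isPrime hP hP0, hPp, card_quotient_span_natCast, hdeg] at hcard
  refine Nat.eq_of_mul_eq_mul_right hp.pos (hcard.trans ?_)
  ring

theorem card_units_quotient_of_inert (hdeg : Module.finrank ℚ L = 2) {p : ℕ} (hp : p.Prime)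
    (h : (Ideal.span {(p : 𝓞 L)}).IsPrime) :
    Nat.card (𝓞 L ⧸ Ideal.span {(p : 𝓞 L)})ˣ = (p - 1) * (p + 1) := by
  rw [card_units_quotient_of_isPrime h, card_quotient_span_natCast, hdeg, mul_comm,
    ← Nat.sq_sub_sq, one_pow]
  simpa using hp.ne_zero

theorem eq_one_or_neg_one_of_isUnit (hdeg : Module.finrank ℚ L = 2) (himag : IsEmpty (L →+* ℝ))
    (hroots : ∀ x : L, (∃ n : ℕ, 0 < n ∧ x ^ n = 1) → x = 1 ∨ x = -1) (u : (𝓞 L)ˣ) :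
    u = 1 ∨ u = -1 := by
  have hreal : InfinitePlace.nrRealPlaces L = 0 := by
    classical
    rw [InfinitePlace.nrRealPlaces, Fintype.card_eq_zero_iff]
    exact ⟨fun w ↦ himag.false (InfinitePlace.embedding_of_isReal w.2)⟩
  have hrank : Units.rank L = 0 := by
    have h1 := InfinitePlace.card_add_two_mul_card_eq_rank L
    rw [Units.rank, InfinitePlace.card_eq_nrRealPlaces_add_nrComplexPlaces]
    lia
  obtain ⟨⟨ζ, e⟩, hu, -⟩ := Units.exist_unique_eq_mul_prod L u
  have : IsEmpty (Fin (Units.rank L)) := by rw [hrank]; infer_instance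
  rw [Finset.univ_eq_empty, Finset.prod_empty, mul_one] at hu
  obtain ⟨n, hn, hn'⟩ := (isOfFinOrder_iff_pow_eq_one).mp ((CommGroup.mem_torsion _).mp ζ.2)
  have hx := hroots (algebraMap (𝓞 L) L (ζ : (𝓞 L)ˣ)) ⟨n, hn, by
    rw [← map_pow, ← Units.val_pow_eq_pow_val, hn', Units.val_one, map_one]⟩
  subst hu
  refine hx.imp (fun h ↦ ?_) (fun h ↦ ?_)
  · ext
    simpa using h
  · ext
    simpa using h

theorem intCast_mem_span_natCast_iff {m : ℕ} {a : ℤ} :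
    (a : 𝓞 L) ∈ Ideal.span {(m : 𝓞 L)} ↔ (m : ℤ) ∣ a := by
  rw [Ideal.mem_span_singleton]
  constructor
  · intro h
    have := map_dvd (Algebra.norm ℤ) h
    rw [← map_natCast (algebraMap ℤ (𝓞 L)), ← eq_intCast (algebraMap ℤ (𝓞 L)),
      Algebra.norm_algebraMap, Algebra.norm_algebraMap, Int.pow_dvd_pow_iff] at this
    · exact_mod_cast this
    · exact Module.finrank_pos.ne'
  · intro h
    simpa using map_dvd (Int.castRingHom (𝓞 L)) h

end Quadratic

end Picard

section Order

open NumberField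

/-- The inclusion of the order of conductor `m` into the ring of integers. -/
def orderInclusion (L : Type) [Field L] (m : ℕ) : orderSubring L m →+* 𝓞 L :=
  (orderSubring L m).subtype.codRestrict (integralClosure ℤ L) <| by
    rintro ⟨_, a, y, rfl⟩
    change IsIntegral ℤ _
    simpa using (isIntegral_algebraMap (R := ℤ) (x := a)).add
      ((isIntegral_algebraMap (R := ℤ) (x := m)).mul y.isIntegral_coe)

theorem coe_orderInclusion (L : Type) [Field L] (m : ℕ) (x : orderSubring L m) :
    (orderInclusion L m x : L) = x := rfl

theorem exists_orderInclusion_eq (L : Type) [Field L] (m : ℕ) (a : ℤ) (y : 𝓞 L) :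
    ∃ r, orderInclusion L m r = a + m * y :=
  ⟨⟨_, a, y, rfl⟩, by ext; simp [coe_orderInclusion]⟩

theorem card_classGroup_orderSubring (hdeg : Module.finrank ℚ K = 2)
    (himag : IsEmpty (K →+* ℝ))
    (hroots : ∀ x : K, (∃ n : ℕ, 0 < n ∧ x ^ n = 1) → x = 1 ∨ x = -1)
    {m : ℕ} (hm : m ≠ 0) {c : ℕ → ℕ} (hc : ∀ p, p.Prime → p ∣ m →
      Nat.card (𝓞 K ⧸ Ideal.span {(p : 𝓞 K)})ˣ = (p - 1) * c p) :
    Nat.card (ClassGroup (orderSubring K m)) = Nat.card (ClassGroup (𝓞 K)) *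
      ∏ p ∈ m.primeFactors, p ^ (m.factorization p - 1) * c p := by
  let : Algebra (orderSubring K m) (𝓞 K) := (orderInclusion K m).toAlgebra
  have hmap (r) : algebraMap (orderSubring K m) (𝓞 K) r = orderInclusion K m r := rfl
  have : FaithfulSMul (orderSubring K m) (𝓞 K) :=
    (faithfulSMul_iff_algebraMap_injective _ _).mpr fun x y hxy ↦
      Subtype.ext (congrArg (algebraMap (𝓞 K) K) hxy)
  have hf : ∀ z ∈ Ideal.span {(m : 𝓞 K)}, ∃ r, algebraMap (orderSubring K m) (𝓞 K) r = z := by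
    intro z hz
    obtain ⟨y, rfl⟩ := Ideal.mem_span_singleton.mp hz
    simpa [hmap] using exists_orderInclusion_eq K m 0 y
  have hf₀ : Ideal.span {(m : 𝓞 K)} ≠ ⊥ := by simpa using hm
  have hR : ∀ r : orderSubring K m, ∃ a : ℤ,
      algebraMap (orderSubring K m) (𝓞 K) r - a ∈ Ideal.span {(m : 𝓞 K)} := by
    rintro ⟨_, a, y, rfl⟩
    refine ⟨a, Ideal.mem_span_singleton.mpr ⟨y, ?_⟩⟩
    ext
    simp [hmap, coe_orderInclusion]
  have hunits : ∀ u : (𝓞 K)ˣ, ∃ r : (orderSubring K m)ˣ,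
      algebraMap (orderSubring K m) (𝓞 K) r = u := by
    intro u
    rcases eq_one_or_neg_one_of_isUnit hdeg himag hroots u with rfl | rfl
    · exact ⟨1, by simp⟩
    · exact ⟨-1, by simp⟩
  rw [Nat.card_congr (ClassGroup.equivPic (orderSubring K m)).toEquiv,
    Nat.card_congr (ClassGroup.equivPic (𝓞 K)).toEquiv,
    card_pic_eq_mul_card_units_submodule (mapAlgebra_surjective_of_conductor hf₀ hf) hunits]
  congr 1
  have h := card_units_submodule_mul_totient hf hm (Ideal.mem_span_singleton_self _) hR
    fun a ↦ intCast_mem_span_natCast_iff.mp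
  rw [card_units_quotient_span_natCast hdeg hm hc, mul_comm] at h
  exact Nat.eq_of_mul_eq_mul_left (Nat.totient_pos.mpr (Nat.pos_of_ne_zero hm)) h

theorem card_units_quotient_span_prime (hdeg : Module.finrank ℚ K = 2) {p : ℕ} (hp : p.Prime)
    {χ : ℤ}
    (hχ : (SplitsIn K p ∧ χ = 1) ∨ (RamifiesIn K p ∧ χ = 0) ∨ (InertIn K p ∧ χ = -1)) :
    Nat.card (𝓞 K ⧸ Ideal.span {(p : 𝓞 K)})ˣ = (p - 1) * (p - χ).toNat ∧ χ ≤ p := by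
  have hp1 := hp.one_le
  rcases hχ with ⟨⟨P, Q, hP, hQ, hPQ, h⟩, rfl⟩ | ⟨⟨P, hP, h⟩, rfl⟩ | ⟨h, rfl⟩
  · exact ⟨by rw [card_units_quotient_of_split hdeg hp hP hQ hPQ h]; congr 1; lia, by lia⟩
  · exact ⟨by rw [card_units_quotient_of_ramified hdeg hp hP h]; congr 1, by lia⟩
  · exact ⟨by rw [card_units_quotient_of_inert hdeg hp h]; congr 1, by lia⟩

end Order

/-- The class number formula for orders:
`#Pic(O_m) = h · ∏_{p ∣ m} p^{v_p(m)−1}·(p − χ_K(p))`. -/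
theorem picard_order_card
    (hdeg : Module.finrank ℚ K = 2)
    (himag : IsEmpty (K →+* ℝ))
    (hroots : ∀ x : K, (∃ n : ℕ, 0 < n ∧ x ^ n = 1) → x = 1 ∨ x = -1)
    (m : ℕ) (hm : 0 < m)
    (χ : ℕ → ℤ)
    (hχ : ∀ q : ℕ, q.Prime → q ∣ m →
      (SplitsIn K q ∧ χ q = 1) ∨ (RamifiesIn K q ∧ χ q = 0) ∨
        (InertIn K q ∧ χ q = -1)) :
    (Nat.card (ClassGroup (orderSubring K m)) : ℤ) =
      (Nat.card (ClassGroup (NumberField.RingOfIntegers K)) : ℤ) *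
        ∏ p ∈ m.primeFactors,
          ((p : ℤ) ^ (m.factorization p - 1) * ((p : ℤ) - χ p)) := by
  rw [card_classGroup_orderSubring K hdeg himag hroots hm.ne' (c := fun p ↦ (p - χ p).toNat)
    fun p hp hpm ↦ (card_units_quotient_span_prime K hdeg hp (hχ p hp hpm)).1, Nat.cast_mul,
    Nat.cast_prod]
  refine congrArg _ (Finset.prod_congr rfl fun p hp ↦ ?_)
  have hp' := Nat.prime_of_mem_primeFactors hp
  have hle := (card_units_quotient_span_prime K hdeg hp'
    (hχ p hp' (Nat.dvd_of_mem_primeFactors hp))).2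
  rw [Nat.cast_mul, Nat.cast_pow, Int.toNat_of_nonneg (sub_nonneg.mpr hle)]

end
end

section
/- Let K be an imaginary quadratic field, let f be a positive integer, and let g, ℓ be positive integers with g ∣ ℓ and ℓ ∣ f. For any rank-1 K-lattice L of conductor f, the number of rank-1 K-lattices L′ with L ⊆ L′ such that L′/L is cyclic of order f/ℓ and L′ has conductor g equals 1 if g = ℓ, and equals 0 if g ≠ ℓ. -/
noncomputable section

variable (K : Type) [Field K] [NumberField K]

/-- The ring of integers of a quadratic field has a `ℤ`-basis of the form `1, ω`. -/
theorem exists_integer_generator (hdeg : Module.finrank ℚ K = 2) :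
    ∃ ω : K, (∀ y : NumberField.RingOfIntegers K, ∃ a b : ℤ,
        algebraMap (NumberField.RingOfIntegers K) K y = a + b * ω) ∧
      (∃ y, algebraMap (NumberField.RingOfIntegers K) K y = ω) ∧
      ∀ a b : ℤ, (a : K) + b * ω = 0 → a = 0 ∧ b = 0 := by
  have hrank : Module.finrank ℤ (NumberField.RingOfIntegers K) = 2 := by
    rw [NumberField.RingOfIntegers.rank, hdeg]
  let B := Module.finBasisOfFinrankEq ℤ (NumberField.RingOfIntegers K) hrank
  have hB (y : NumberField.RingOfIntegers K) :
      y = (B.repr y 0 : NumberField.RingOfIntegers K) * B 0 + (B.repr y 1) * B 1 := by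
    conv_lhs => rw [← B.sum_repr y]
    simp [Fin.sum_univ_two, zsmul_eq_mul]
  have hBind (c d : ℤ) (h : (c : NumberField.RingOfIntegers K) * B 0 + d * B 1 = 0) :
      c = 0 ∧ d = 0 := by
    have := Fintype.linearIndependent_iff.mp B.linearIndependent ![c, d]
      (by simpa [Fin.sum_univ_two, zsmul_eq_mul] using h)
    exact ⟨by simpa using this 0, by simpa using this 1⟩
  have h_one := hB 1
  set p := B.repr 1 0
  set q := B.repr 1 1
  have hpq : IsCoprime p q := by
    rw [Int.isCoprime_iff_gcd_eq_one]
    obtain ⟨p', hp'⟩ := Int.gcd_dvd_left p q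
    obtain ⟨q', hq'⟩ := Int.gcd_dvd_right p q
    set d : ℤ := (Int.gcd p q : ℤ) with hd
    have hz : (1 : NumberField.RingOfIntegers K) = d * (p' * B 0 + q' * B 1) := by
      conv_lhs => rw [h_one, hp', hq']
      push_cast; ring
    have hunit : IsUnit d := by
      have h := congrArg (Algebra.norm ℤ) hz
      rw [map_one, map_mul, ← eq_intCast (algebraMap ℤ (NumberField.RingOfIntegers K)),
        Algebra.norm_algebraMap, hrank] at h
      exact (isUnit_pow_iff two_ne_zero).mp (IsUnit.of_mul_eq_one _ h.symm)
    have := Int.isUnit_iff_natAbs_eq.mp hunit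
    simpa [hd] using this
  obtain ⟨s, t, hst⟩ := hpq
  have hst' : (s : NumberField.RingOfIntegers K) * p + t * q = 1 := by exact_mod_cast hst
  let w : NumberField.RingOfIntegers K := -t * B 0 + s * B 1
  have hw (y : NumberField.RingOfIntegers K) : ∃ a b : ℤ, y = a + b * w := by
    refine ⟨B.repr y 0 * s + B.repr y 1 * t, -(B.repr y 0 * q) + B.repr y 1 * p, ?_⟩
    conv_lhs => rw [hB y]
    push_cast
    simp only [w]
    linear_combination
      (- (B.repr y 0 : NumberField.RingOfIntegers K) * B 0 - B.repr y 1 * B 1) * hst'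
      - (B.repr y 0 * s + B.repr y 1 * t : NumberField.RingOfIntegers K) * h_one
  refine ⟨algebraMap _ K w, fun y => ?_, ⟨w, rfl⟩, fun a b h => ?_⟩
  · obtain ⟨a, b, h⟩ := hw y
    exact ⟨a, b, by conv_lhs => rw [h]
                    simp⟩
  · have h' : (a : NumberField.RingOfIntegers K) + b * w = 0 := by
      apply NumberField.RingOfIntegers.coe_injective
      simpa using h
    obtain ⟨h1, h2⟩ := hBind (a * p - b * t) (a * q + b * s) (by
      push_cast
      simp only [w] at h'
      linear_combination h' - (a : NumberField.RingOfIntegers K) * h_one)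
    constructor
    · linear_combination s * h1 + t * h2 - a * hst
    · linear_combination -q * h1 + p * h2 - b * hst

/-- A lattice in a quadratic field has a `ℤ`-basis with two elements. -/
theorem IsLat.exists_basis (hdeg : Module.finrank ℚ K = 2) {L : Submodule ℤ K}
    (hL : IsLat K L) : ∃ e₁ ∈ L, ∃ e₂ ∈ L,
      (∀ x ∈ L, ∃ a b : ℤ, x = a * e₁ + b * e₂) ∧
      ∀ a b : ℤ, (a : K) * e₁ + b * e₂ = 0 → a = 0 ∧ b = 0 := by
  have : Module.Finite ℤ L := Module.Finite.iff_fg.mpr hL.1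
  let B := Module.Free.chooseBasis ℤ L
  have hli : LinearIndependent ℤ (fun i => (B i : K)) :=
    B.linearIndependent.map' L.subtype (Submodule.ker_subtype L)
  have hspan : Submodule.span ℤ (Set.range fun i => (B i : K)) = L := by
    have := congrArg (Submodule.map L.subtype) B.span_eq
    rw [Submodule.map_span, Submodule.map_top, Submodule.range_subtype, ← Set.range_comp] at this
    exact this
  have hspan' : ⊤ ≤ Submodule.span ℚ (Set.range fun i => (B i : K)) := by
    rw [← Submodule.span_span_of_tower ℤ ℚ, hspan, hL.2]
  let C := Module.Basis.mk ((LinearIndependent.iff_fractionRing ℤ ℚ).mp hli) hspan'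
  have hcard : Module.finrank ℤ L = 2 := by
    rw [Module.finrank_eq_card_basis B, ← Module.finrank_eq_card_basis C, hdeg]
  let D := Module.finBasisOfFinrankEq ℤ L hcard
  refine ⟨D 0, (D 0).2, D 1, (D 1).2, fun x hx => ⟨D.repr ⟨x, hx⟩ 0, D.repr ⟨x, hx⟩ 1, ?_⟩,
    fun a b h => ?_⟩
  · have := congrArg Subtype.val (D.sum_repr ⟨x, hx⟩)
    rw [Fin.sum_univ_two] at this
    simpa only [Submodule.coe_add, Submodule.coe_smul, zsmul_eq_mul] using this.symm
  · have := Fintype.linearIndependent_iff.mp D.linearIndependent ![a, b] (by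
      apply Subtype.ext
      simpa [Fin.sum_univ_two, zsmul_eq_mul] using h)
    exact ⟨by simpa using this 0, by simpa using this 1⟩

theorem mem_orderSet_iff {ω : K} (hω : ∀ y : NumberField.RingOfIntegers K, ∃ a b : ℤ,
      algebraMap (NumberField.RingOfIntegers K) K y = a + b * ω)
    (hω' : ∃ y, algebraMap (NumberField.RingOfIntegers K) K y = ω) (m : ℕ) (x : K) :
    x ∈ orderSet K m ↔ ∃ a b : ℤ, x = a + b * (m * ω) := by
  constructor
  · rintro ⟨a, y, rfl⟩
    obtain ⟨b, c, h⟩ := hω y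
    exact ⟨a + m * b, c, by rw [h]; push_cast; ring⟩
  · rintro ⟨a, b, rfl⟩
    obtain ⟨y, rfl⟩ := hω'
    exact ⟨a, b * y, by simp; ring⟩

/-- If `n` is the least exponent with `n β L ⊆ L`, then some `β v` has exact order `n`
modulo `L`. -/
theorem exists_order_eq {L : Submodule ℤ K} {β : K} {n : ℕ} (hn : 0 < n)
    (h : ∀ m : ℕ, (∀ x ∈ L, (m : K) * (β * x) ∈ L) ↔ n ∣ m) :
    ∃ v ∈ L, ∀ m : ℕ, (m : K) * (β * v) ∈ L ↔ n ∣ m := by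
  let φ : L →ₗ[ℤ] K ⧸ L := L.mkQ ∘ₗ LinearMap.mulLeft ℤ β ∘ₗ L.subtype
  have hφ (m : ℕ) (x : L) : m • φ x = 0 ↔ (m : K) * (β * x) ∈ L := by
    rw [← Submodule.Quotient.mk_eq_zero, ← nsmul_eq_mul]
    rfl
  have hkill (m : ℕ) : (∀ z : LinearMap.range φ, m • z = 0) ↔ n ∣ m := by
    rw [← h]
    constructor
    · intro hz x hx
      have := congrArg Subtype.val (hz ⟨φ ⟨x, hx⟩, ⟨x, hx⟩, rfl⟩)
      exact (hφ m ⟨x, hx⟩).mp this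
    · rintro hx ⟨_, x, rfl⟩
      exact Subtype.ext ((hφ m x).mpr (hx x x.2))
  have hexp : AddMonoid.exponent (LinearMap.range φ) = n := by
    apply Nat.dvd_antisymm
    · exact AddMonoid.exponent_dvd_of_forall_nsmul_eq_zero ((hkill n).mpr dvd_rfl)
    · exact (hkill _).mp AddMonoid.exponent_nsmul_eq_zero
  obtain ⟨⟨_, v, rfl⟩, hv⟩ := AddMonoid.exists_addOrderOf_eq_exponent
    (AddMonoid.exponent_ne_zero.mp (by omega : AddMonoid.exponent (LinearMap.range φ) ≠ 0))
  refine ⟨v, v.2, fun m => ?_⟩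
  rw [← hφ, ← hexp, ← hv, addOrderOf_dvd_iff_nsmul_eq_zero, Subtype.ext_iff]
  rfl

theorem addOrderOf_quotLat_mk {L L' : Submodule ℤ K} {u : K} (hu : u ∈ L') {n : ℕ}
    (hord : ∀ m : ℕ, (m : K) * u ∈ L ↔ n ∣ m) :
    addOrderOf (show quotLat K L L' from (L.comap L'.subtype).mkQ ⟨u, hu⟩) = n := by
  let π : L' → quotLat K L L' := (L.comap L'.subtype).mkQ
  have hm (m : ℕ) : m • π ⟨u, hu⟩ = 0 ↔ n ∣ m := by
    rw [← hord, ← nsmul_eq_mul]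
    exact Submodule.Quotient.mk_eq_zero (L.comap L'.subtype) (x := m • ⟨u, hu⟩)
  apply Nat.dvd_antisymm
  · exact addOrderOf_dvd_of_nsmul_eq_zero ((hm n).mpr dvd_rfl)
  · exact (hm _).mp (addOrderOf_nsmul_eq_zero _)

/-- A superlattice `L'` of `L` containing an element `u` of exact order `n` modulo `L` is
`L + ℤ u` as soon as `L' / L` has order `n`. -/
theorem eq_sup_span_of_card_eq {L L' : Submodule ℤ K} (hLL' : L ≤ L') {u : K} (hu : u ∈ L')
    {n : ℕ} (hn : 0 < n) (hord : ∀ m : ℕ, (m : K) * u ∈ L ↔ n ∣ m)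
    (hcard : Nat.card (quotLat K L L') = n) : L' = L ⊔ Submodule.span ℤ {u} := by
  let π : L' → quotLat K L L' := (L.comap L'.subtype).mkQ
  have hπ (y : L') : π y = 0 ↔ (y : K) ∈ L :=
    Submodule.Quotient.mk_eq_zero (L.comap L'.subtype)
  have hadd : addOrderOf (π ⟨u, hu⟩) = n := addOrderOf_quotLat_mk K hu hord
  have : Finite (quotLat K L L') := Nat.finite_of_card_ne_zero (by omega)
  have htop : AddSubgroup.zmultiples (π ⟨u, hu⟩) = ⊤ := by
    apply AddSubgroup.eq_top_of_card_eq
    rw [Nat.card_zmultiples, hadd, hcard]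
  apply le_antisymm
  · intro x hx
    obtain ⟨k, hk⟩ := AddSubgroup.mem_zmultiples_iff.mp
      (htop ▸ AddSubgroup.mem_top (π ⟨x, hx⟩) : π ⟨x, hx⟩ ∈ AddSubgroup.zmultiples (π ⟨u, hu⟩))
    have hmem : x - k • u ∈ L := by
      apply (hπ (⟨x, hx⟩ - k • ⟨u, hu⟩)).mp
      exact sub_eq_zero.mpr hk.symm
    exact Submodule.mem_sup.mpr ⟨_, hmem, k • u,
      Submodule.smul_mem _ _ (Submodule.mem_span_singleton_self u), by abel⟩
  · exact sup_le hLL' (by simpa using hu)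

theorem quotLat_sup_span {L : Submodule ℤ K} {u : K} {n : ℕ}
    (hord : ∀ m : ℕ, (m : K) * u ∈ L ↔ n ∣ m) :
    IsAddCyclic (quotLat K L (L ⊔ Submodule.span ℤ {u})) ∧
      Nat.card (quotLat K L (L ⊔ Submodule.span ℤ {u})) = n := by
  set L' := L ⊔ Submodule.span ℤ {u}
  have hu : u ∈ L' := Submodule.mem_sup_right (Submodule.mem_span_singleton_self u)
  let π : L' → quotLat K L L' := (L.comap L'.subtype).mkQ
  have hπ (y : L') : π y = 0 ↔ (y : K) ∈ L :=
    Submodule.Quotient.mk_eq_zero (L.comap L'.subtype)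
  have hadd : addOrderOf (π ⟨u, hu⟩) = n := addOrderOf_quotLat_mk K hu hord
  have hgen : ∀ z : quotLat K L L', z ∈ AddSubgroup.zmultiples (π ⟨u, hu⟩) := by
    intro z
    obtain ⟨⟨x, hx⟩, rfl⟩ := (L.comap L'.subtype).mkQ_surjective z
    obtain ⟨y, hy, w, hw, rfl⟩ := Submodule.mem_sup.mp hx
    obtain ⟨k, rfl⟩ := Submodule.mem_span_singleton.mp hw
    refine AddSubgroup.mem_zmultiples_iff.mpr ⟨k, sub_eq_zero.mp ?_⟩
    apply (hπ (k • ⟨u, hu⟩ - ⟨y + k • u, hx⟩)).mpr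
    show k • u - (y + k • u) ∈ L
    simpa using hy
  refine ⟨⟨⟨_, hgen⟩⟩, ?_⟩
  rw [← hadd, ← Nat.card_zmultiples, (AddSubgroup.eq_top_iff' _).mpr hgen]
  exact (Nat.card_congr AddSubgroup.topEquiv.toEquiv).symm

/-- An element `β` with integral trace and norm for which `n β L ⊆ L` maps `L` into `L + ℤ β v`
whenever `β v` has exact order `n` modulo `L`. -/
theorem mul_mem_sup_span {L : Submodule ℤ K} {e₁ e₂ β v : K} (he₁ : e₁ ∈ L) (he₂ : e₂ ∈ L)
    (hspan : ∀ x ∈ L, ∃ a b : ℤ, x = a * e₁ + b * e₂)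
    (hind : ∀ a b : ℤ, (a : K) * e₁ + b * e₂ = 0 → a = 0 ∧ b = 0)
    {n : ℕ} (hn : 0 < n) {T N : ℤ} (hβ : β * β = T * β - N)
    (hirr : ∀ a : ℤ, (n : K) * β ≠ a)
    (hnβ : ∀ x ∈ L, (n : K) * (β * x) ∈ L)
    (hv : v ∈ L) (hord : ∀ m : ℕ, (m : K) * (β * v) ∈ L ↔ n ∣ m) {x : K} (hx : x ∈ L) :
    β * x ∈ L ⊔ Submodule.span ℤ {β * v} := by
  obtain ⟨a, c, h₁⟩ := hspan _ (hnβ e₁ he₁)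
  obtain ⟨b, d, h₂⟩ := hspan _ (hnβ e₂ he₂)
  obtain ⟨v₁, v₂, rfl⟩ := hspan v hv
  obtain ⟨x₁, x₂, rfl⟩ := hspan x hx
  have hn' : (n : K) ≠ 0 := by exact_mod_cast hn.ne'
  obtain ⟨h11, h12⟩ := hind (a * a + c * b - n * T * a + n * n * N)
    (a * c + c * d - n * T * c) (by
      push_cast
      linear_combination (n * n * e₁) * hβ - (n * β + a - n * T) * h₁ - c * h₂)
  obtain ⟨h21, h22⟩ := hind (b * a + d * b - n * T * b)
    (b * c + d * d - n * T * d + n * n * N) (by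
      push_cast
      linear_combination (n * n * e₂) * hβ - (n * β + d - n * T) * h₂ - b * h₁)
  have htr : a + d = n * T := by
    by_contra hne
    have hne' : a + d - n * T ≠ 0 := sub_ne_zero.mpr hne
    have hc : c = 0 := (mul_eq_zero.mp (by linear_combination h12 :
      c * (a + d - n * T) = 0)).resolve_right hne'
    subst hc
    apply hirr a
    have he : e₁ ≠ 0 := by
      rintro rfl
      exact one_ne_zero (hind 1 0 (by simp)).1
    apply mul_right_cancel₀ he
    linear_combination h₁
  have hdet : a * d - b * c = n * n * N := by
    linear_combination a * htr - h11
  set u₁ := a * v₁ + b * v₂ with hu₁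
  set u₂ := c * v₁ + d * v₂ with hu₂
  set y₁ := a * x₁ + b * x₂ with hy₁
  set y₂ := c * x₁ + d * x₂ with hy₂
  have hu : (n : K) * (β * (v₁ * e₁ + v₂ * e₂)) = u₁ * e₁ + u₂ * e₂ := by
    rw [hu₁, hu₂]; push_cast
    linear_combination (v₁ : K) * h₁ + v₂ * h₂
  have hy : (n : K) * (β * (x₁ * e₁ + x₂ * e₂)) = y₁ * e₁ + y₂ * e₂ := by
    rw [hy₁, hy₂]; push_cast
    linear_combination (x₁ : K) * h₁ + x₂ * h₂
  have hyu : u₁ * y₂ - u₂ * y₁ = n * (n * N * (v₁ * x₂ - v₂ * x₁)) := by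
    rw [hu₁, hu₂, hy₁, hy₂]
    linear_combination (v₁ * x₂ - v₂ * x₁) * hdet
  have hLmem (r s : ℤ) : (r : K) * e₁ + s * e₂ ∈ L := by
    simpa [zsmul_eq_mul] using L.add_mem (L.smul_mem r he₁) (L.smul_mem s he₂)
  have hgcd : Int.gcd (Int.gcd u₁ u₂) n = 1 := by
    have hdn : Int.gcd (Int.gcd u₁ u₂) n ∣ n := by
      exact_mod_cast Int.gcd_dvd_right (Int.gcd u₁ u₂ : ℤ) n
    have hd0 : (Int.gcd (Int.gcd u₁ u₂) n : ℤ) ∣ Int.gcd u₁ u₂ := Int.gcd_dvd_left _ _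
    obtain ⟨r, hr⟩ := hd0.trans (Int.gcd_dvd_left u₁ u₂)
    obtain ⟨s, hs⟩ := hd0.trans (Int.gcd_dvd_right u₁ u₂)
    obtain ⟨m, hm⟩ := hdn
    set δ := Int.gcd (Int.gcd u₁ u₂) n
    have hδ : (δ : K) ≠ 0 := by
      have : δ ≠ 0 := by rintro h0; rw [h0, zero_mul] at hm; omega
      exact_mod_cast this
    have hmem : (m : K) * (β * (v₁ * e₁ + v₂ * e₂)) ∈ L := by
      have : (m : K) * (β * (v₁ * e₁ + v₂ * e₂)) = r * e₁ + s * e₂ := by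
        apply mul_left_cancel₀ hδ
        have hm' : (n : K) = δ * m := by exact_mod_cast hm
        have hr' : (u₁ : K) = δ * r := by exact_mod_cast hr
        have hs' : (u₂ : K) = δ * s := by exact_mod_cast hs
        rw [hm', hr', hs'] at hu
        linear_combination hu
      rw [this]; exact hLmem r s
    obtain ⟨k, hk⟩ := (hord m).mp hmem
    have : δ * k = 1 := by
      apply Nat.eq_of_mul_eq_mul_left hn
      calc n * (δ * k) = δ * (n * k) := by ring
        _ = n * 1 := by rw [← hk, ← hm, mul_one]
    exact Nat.eq_one_of_mul_eq_one_right this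
  obtain ⟨s, t, r, hbez⟩ : ∃ s t r : ℤ, s * u₁ + t * u₂ + r * n = 1 := by
    have hb₁ := Int.gcd_eq_gcd_ab u₁ u₂
    have hb₂ := Int.gcd_eq_gcd_ab (Int.gcd u₁ u₂ : ℤ) n
    rw [hgcd] at hb₂
    refine ⟨Int.gcdA u₁ u₂ * Int.gcdA (Int.gcd u₁ u₂ : ℤ) n,
      Int.gcdB u₁ u₂ * Int.gcdA (Int.gcd u₁ u₂ : ℤ) n, Int.gcdB (Int.gcd u₁ u₂ : ℤ) n, ?_⟩
    push_cast at hb₂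
    linear_combination -hb₂ - Int.gcdA (Int.gcd u₁ u₂ : ℤ) n * hb₁
  set z := n * N * (v₁ * x₂ - v₂ * x₁) with hz
  set k := s * y₁ + t * y₂ with hk
  have hk₁ : y₁ = k * u₁ + n * (r * y₁ - t * z) := by
    linear_combination -y₁ * hbez - t * hyu
  have hk₂ : y₂ = k * u₂ + n * (r * y₂ + s * z) := by
    linear_combination -y₂ * hbez + s * hyu
  have hk₁' : (y₁ : K) = k * u₁ + n * ((r * y₁ - t * z : ℤ) : K) := by exact_mod_cast hk₁
  have hk₂' : (y₂ : K) = k * u₂ + n * ((r * y₂ + s * z : ℤ) : K) := by exact_mod_cast hk₂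
  refine Submodule.mem_sup.mpr ⟨_, hLmem (r * y₁ - t * z) (r * y₂ + s * z),
    k • (β * (v₁ * e₁ + v₂ * e₂)),
    Submodule.smul_mem _ _ (Submodule.mem_span_singleton_self _), ?_⟩
  apply mul_left_cancel₀ hn'
  rw [zsmul_eq_mul]
  linear_combination k * hu - hy - e₁ * hk₁' - e₂ * hk₂'

/-- A rational number stabilizing a lattice is an integer. -/
theorem exists_int_of_mem_multLat (hdeg : Module.finrank ℚ K = 2) {L : Submodule ℤ K}
    (hL : IsLat K L) {q : ℚ} (hq : (q : K) ∈ multLat K L) : ∃ a : ℤ, q = a := by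
  have hint : IsIntegral ℤ (q : K) := by
    obtain ⟨e₁, he₁, e₂, -, -, hind⟩ := hL.exists_basis K hdeg
    have he : e₁ ≠ 0 := by
      rintro rfl
      exact one_ne_zero (hind 1 0 (by simp)).1
    exact isIntegral_of_smul_mem_submodule (N := L) (fun h => he (by
      rw [h] at he₁; simpa using he₁)) hL.1 _ (fun x hx => hq x hx)
  have hint' : IsIntegral ℤ q :=
    (isIntegral_algebraMap_iff (algebraMap ℚ K).injective).mp (by simpa using hint)
  obtain ⟨a, ha⟩ := IsIntegrallyClosed.isIntegral_iff.mp hint'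
  exact ⟨a, by simpa using ha.symm⟩

/-- For a lattice `L` of conductor `f` and `g ∣ ℓ ∣ f`: the number of superlattices
`L' ⊇ L` with `L'/L` cyclic of order `f/ℓ` and `L'` of conductor `g` is `1` if `g = ℓ`
and `0` otherwise. -/
theorem cnt_for_maximal_conductor
    (hdeg : Module.finrank ℚ K = 2)
    (himag : IsEmpty (K →+* ℝ))
    (f g ℓ : ℕ) (hg : 0 < g) (hgℓ : g ∣ ℓ) (hℓf : ℓ ∣ f) (hf : 0 < f)
    (L : Submodule ℤ K) (hL : IsLat K L) (hcond : HasCond K L f) :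
    cnt K L g (f / ℓ) = if g = ℓ then 1 else 0 := by
  obtain ⟨ω, hω, hω', hωind⟩ := exists_integer_generator K hdeg
  obtain ⟨n, rfl⟩ := hℓf
  have hℓ : 0 < ℓ := Nat.pos_of_mul_pos_right hf
  have hn : 0 < n := Nat.pos_of_mul_pos_left hf
  rw [Nat.mul_div_cancel_left n hℓ]
  have hnK : (n : K) ≠ 0 := by exact_mod_cast hn.ne'
  have hmult (x : K) : (∀ y ∈ L, x * y ∈ L) ↔ ∃ a b : ℤ, x = a + b * ((ℓ * n : ℕ) * ω) := by
    rw [← mem_orderSet_iff K hω hω', ← hcond.2]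
    rfl
  have hmulω (m : ℕ) : (∀ x ∈ L, (m : K) * ω * x ∈ L) ↔ ℓ * n ∣ m := by
    rw [hmult]
    constructor
    · rintro ⟨a, b, h⟩
      have := (hωind a (b * (ℓ * n : ℕ) - m) (by push_cast at h ⊢; linear_combination -h)).2
      exact Int.natCast_dvd_natCast.mp ⟨b, by linear_combination -this⟩
    · rintro ⟨k, rfl⟩
      exact ⟨0, k, by push_cast; ring⟩
  have hkill (m : ℕ) : (∀ x ∈ L, (m : K) * (ℓ * ω * x) ∈ L) ↔ n ∣ m := by
    rw [← Nat.mul_dvd_mul_iff_left hℓ, ← hmulω]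
    refine forall₂_congr fun x _ => ?_
    rw [show (m : K) * (ℓ * ω * x) = (ℓ * m : ℕ) * ω * x by push_cast; ring]
  obtain ⟨v, hv, hord⟩ := exists_order_eq K hn hkill
  set u := (ℓ : K) * ω * v with hu_def
  have huniq (L' : Submodule ℤ K) (hLL' : L ≤ L') (hcard : Nat.card (quotLat K L L') = n)
      (hc : HasCond K L' g) : L' = L ⊔ Submodule.span ℤ {u} := by
    refine eq_sup_span_of_card_eq K hLL' ?_ hn hord hcard
    have : (ℓ : K) * ω ∈ (multLat K L' : Set K) := by
      rw [hc.2, mem_orderSet_iff K hω hω']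
      obtain ⟨k, rfl⟩ := hgℓ
      exact ⟨0, k, by push_cast; ring⟩
    exact this v (hLL' hv)
  have hnL' : ∀ x ∈ L ⊔ Submodule.span ℤ {u}, (n : K) * x ∈ L := by
    intro x hx
    obtain ⟨y, hy, w, hw, rfl⟩ := Submodule.mem_sup.mp hx
    obtain ⟨k, rfl⟩ := Submodule.mem_span_singleton.mp hw
    have := L.add_mem (L.smul_mem (n : ℤ) hy) (L.smul_mem k ((hord n).mpr dvd_rfl))
    convert this using 1
    simp only [zsmul_eq_mul]; push_cast; ring
  have hL' : IsLat K (L ⊔ Submodule.span ℤ {u}) := by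
    refine ⟨hL.1.sup (Submodule.fg_span_singleton u), top_le_iff.mp ?_⟩
    rw [← hL.2]
    exact Submodule.span_mono (le_sup_left : L ≤ _)
  rw [cnt]
  split_ifs with h
  · subst h
    obtain ⟨e₁, he₁, e₂, he₂, hspan, hind⟩ := hL.exists_basis K hdeg
    obtain ⟨N, T, hTN⟩ : ∃ a b : ℤ, ω * ω = a + b * ω := by
      obtain ⟨y, rfl⟩ := hω'
      simpa using hω (y * y)
    have hβ : (g * ω : K) * (g * ω) = (g * T : ℤ) * (g * ω) - (-(g * g * N) : ℤ) := by
      push_cast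
      linear_combination (g * g : K) * hTN
    have hβL : ∀ x ∈ L, (g : K) * ω * x ∈ L ⊔ Submodule.span ℤ {u} := fun x hx =>
      mul_mem_sup_span K he₁ he₂ hspan hind hn hβ (fun a ha => by
        have := (hωind (-a) (n * g) (by push_cast; linear_combination ha)).2
        exact (by positivity : (n * g : ℤ) ≠ 0) this)
        ((hkill n).mpr dvd_rfl) hv hord hx
    have hβL' : ∀ x ∈ L ⊔ Submodule.span ℤ {u},
        (g : K) * ω * x ∈ L ⊔ Submodule.span ℤ {u} := by
      intro x hx
      obtain ⟨y, hy, w, hw, rfl⟩ := Submodule.mem_sup.mp hx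
      obtain ⟨k, rfl⟩ := Submodule.mem_span_singleton.mp hw
      have hu : (g : K) * ω * u ∈ L ⊔ Submodule.span ℤ {u} := by
        have := Submodule.add_mem _
          (Submodule.smul_mem _ (g * T : ℤ) (hβL v hv))
          (Submodule.smul_mem _ (g * g * N : ℤ)
            (Submodule.mem_sup_left hv : v ∈ L ⊔ Submodule.span ℤ {u}))
        convert this using 1
        rw [hu_def, ← mul_assoc, hβ]
        simp only [zsmul_eq_mul]; push_cast; ring
      rw [mul_add, mul_smul_comm]
      exact Submodule.add_mem _ (hβL y hy) (Submodule.smul_mem _ k hu)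
    have hcond' : HasCond K (L ⊔ Submodule.span ℤ {u}) g := by
      refine ⟨hg, Set.ext fun x => ?_⟩
      rw [mem_orderSet_iff K hω hω']
      constructor
      · intro hx
        have hxL' : ∀ y ∈ L ⊔ Submodule.span ℤ {u}, x * y ∈ L ⊔ Submodule.span ℤ {u} := hx
        obtain ⟨a, b, hab⟩ := (hmult (n * x)).mp fun y hy => by
          rw [mul_assoc]
          exact hnL' _ (hxL' y (Submodule.mem_sup_left hy))
        have hxeq : x = ((a / n : ℚ) : K) + b * (g * ω) := by
          apply mul_left_cancel₀ hnK
          push_cast at hab ⊢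
          rw [mul_add, mul_div_cancel₀ _ hnK]
          linear_combination hab
        obtain ⟨c, hc⟩ := exists_int_of_mem_multLat K hdeg hL' (q := a / n) (by
          intro y hy
          have := Submodule.sub_mem _ (hxL' y hy) (Submodule.smul_mem _ b (hβL' y hy))
          convert this using 1
          rw [zsmul_eq_mul, hxeq]; ring)
        exact ⟨c, b, by rw [hxeq, hc]; simp⟩
      · rintro ⟨a, b, rfl⟩ y hy
        have := Submodule.add_mem _ (Submodule.smul_mem _ a hy)
          (Submodule.smul_mem _ b (hβL' y hy))
        convert this using 1
        simp only [zsmul_eq_mul]; ring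
    rw [Nat.card_eq_one_iff_unique]
    obtain ⟨hcyc, hcard⟩ := quotLat_sup_span K hord
    refine ⟨⟨fun A B => Subtype.ext ?_⟩, ⟨⟨_, le_sup_left, hL', hcyc, hcard, hcond'⟩⟩⟩
    rw [huniq A A.2.1 A.2.2.2.2.1 A.2.2.2.2.2, huniq B B.2.1 B.2.2.2.2.1 B.2.2.2.2.2]
  · have : IsEmpty {L' : Submodule ℤ K // L ≤ L' ∧ IsLat K L' ∧ IsAddCyclic (quotLat K L L') ∧
        Nat.card (quotLat K L L') = n ∧ HasCond K L' g} := by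
      refine ⟨fun ⟨L', hLL', _, _, hcard, hc⟩ => h ?_⟩
      have hgω : (g : K) * ω ∈ (multLat K L' : Set K) := by
        rw [hc.2, mem_orderSet_iff K hω hω']
        exact ⟨0, 1, by simp⟩
      have hdvd : ℓ * n ∣ g * n := (hmulω (g * n)).mp fun x hx => by
        have := hnL' _ (huniq L' hLL' hcard hc ▸ hgω x (hLL' hx))
        convert this using 1
        push_cast; ring
      exact Nat.dvd_antisymm hgℓ (Nat.dvd_of_mul_dvd_mul_right hn hdvd)
    exact Nat.card_of_isEmpty

end
end
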